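/- Let (Ω, μ) be a σ-finite measure space, let p ∈ [1, ∞), and let (T_t)_{t ∈ [0,∞)} be a positive and contractive C₀-semigroup on L^p(Ω, μ; ℝ). Assume there exists f₀ ∈ L^p with T_t f₀ = f₀ for all t ≥ 0 and f₀(x) > 0 for μ-almost every x ∈ Ω. Assume in addition condition (*): for every f ∈ L^p with f ≥ 0, f ≠ 0 and T_t f = f for all t ≥ 0, there exist a time t ≥ 0 and a positive integral operator K on L^p such that K g ≤ T_t g for all g ≥ 0 and K f ≠ 0. Then for every f ∈ L^p the limit lim_{t→∞} T_t f exists in the norm of L^p. -/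

import Mathlib

open MeasureTheory Filter
open scoped ENNReal NNReal

noncomputable section

/-- A bounded linear operator on `L^p` is positive if it maps a.e.-nonnegative functions
to a.e.-nonnegative functions. -/
def IsPositiveOp {Ω : Type*} [MeasurableSpace Ω] {μ : Measure Ω} {p : ℝ≥0∞} [Fact (1 ≤ p)]
    (T : Lp ℝ p μ →L[ℝ] Lp ℝ p μ) : Prop :=
  ∀ f : Lp ℝ p μ, 0 ≤ f → 0 ≤ T f

/-- A bounded linear operator on `L^p` is an integral operator if there is a
nonnegative measurable kernel `k : Ω × Ω → [0,∞)` such that for every `f ∈ L^p` the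
function `x ↦ k x y * f x` is integrable for a.e. `y` and
`(T f)(y) = ∫ k x y * f x dμ(x)` for a.e. `y`. -/
def IsIntegralOp {Ω : Type*} [MeasurableSpace Ω] {μ : Measure Ω} {p : ℝ≥0∞} [Fact (1 ≤ p)]
    (T : Lp ℝ p μ →L[ℝ] Lp ℝ p μ) : Prop :=
  ∃ k : Ω → Ω → ℝ, Measurable (Function.uncurry k) ∧ (∀ x y, 0 ≤ k x y) ∧
    ∀ f : Lp ℝ p μ,
      (∀ᵐ y ∂μ, Integrable (fun x => k x y * f x) μ) ∧
      (T f : Ω → ℝ) =ᵐ[μ] fun y => ∫ x, k x y * f x ∂μ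

/-! ### Contraction semigroups on real Hilbert spaces -/

section Hilbert

variable {H : Type*} [NormedAddCommGroup H] [InnerProductSpace ℝ H]

/-- A strongly continuous contraction semigroup. -/
structure IsContractionSemigroup (P : ℝ≥0 → H →L[ℝ] H) : Prop where
  norm_le : ∀ t f, ‖P t f‖ ≤ ‖f‖
  zero_apply : ∀ f, P 0 f = f
  add_apply : ∀ s t f, P (s + t) f = P s (P t f)
  continuous : ∀ f, Continuous fun t => P t f

/-- The common fixed space of a family of operators. -/
def fixedSpace (P : ℝ≥0 → H →L[ℝ] H) : Submodule ℝ H where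
  carrier := {f | ∀ t, P t f = f}
  add_mem' := fun ha hb t => by rw [map_add, ha t, hb t]
  zero_mem' := fun t => map_zero _
  smul_mem' := fun c f hf t => by rw [map_smul, hf t]

theorem mem_fixedSpace {P : ℝ≥0 → H →L[ℝ] H} {f : H} : f ∈ fixedSpace P ↔ ∀ t, P t f = f :=
  Iff.rfl

theorem isClosed_fixedSpace (P : ℝ≥0 → H →L[ℝ] H) : IsClosed (fixedSpace P : Set H) := by
  have : (fixedSpace P : Set H) = ⋂ t, {f | P t f = f} := by
    ext f; simp [mem_fixedSpace]
  rw [this]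
  exact isClosed_iInter fun t => isClosed_eq (P t).continuous continuous_id

theorem eq_of_inner_le {a b : H} (h : ‖b‖ ≤ ‖a‖) (hab : ‖a‖ ^ 2 ≤ inner ℝ a b) : a = b := by
  have h1 := norm_sub_sq_real a b
  have h2 : ‖a - b‖ ^ 2 ≤ 0 := by nlinarith [norm_nonneg b, norm_nonneg a]
  have h3 : ‖a - b‖ = 0 := by nlinarith [norm_nonneg (a - b)]
  exact sub_eq_zero.1 (norm_eq_zero.1 h3)

variable [CompleteSpace H]

instance (P : ℝ≥0 → H →L[ℝ] H) : CompleteSpace (fixedSpace P) :=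
  (isClosed_fixedSpace P).completeSpace_coe

theorem apply_starProjection_fixedSpace (P : ℝ≥0 → H →L[ℝ] H) (t : ℝ≥0) (f : H) :
    P t ((fixedSpace P).starProjection f) = (fixedSpace P).starProjection f :=
  mem_fixedSpace.1 (Submodule.starProjection_apply_mem _ f) t

theorem starProjection_fixedSpace_of_fixed {P : ℝ≥0 → H →L[ℝ] H} {f : H} (hf : ∀ t, P t f = f) :
    (fixedSpace P).starProjection f = f :=
  Submodule.starProjection_eq_self_iff.2 hf

/-- The space of vectors on which all operators of the family are isometric, in the form
`(P t)† (P t) f = f`. -/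
def isometricSpace (P : ℝ≥0 → H →L[ℝ] H) : Submodule ℝ H where
  carrier := {f | ∀ t, (P t).adjoint (P t f) = f}
  add_mem' := fun ha hb t => by rw [map_add, map_add, ha t, hb t]
  zero_mem' := fun t => by rw [map_zero, map_zero]
  smul_mem' := fun c f hf t => by rw [map_smul, map_smul, hf t]

theorem mem_isometricSpace {P : ℝ≥0 → H →L[ℝ] H} {f : H} :
    f ∈ isometricSpace P ↔ ∀ t, (P t).adjoint (P t f) = f :=
  Iff.rfl

theorem isClosed_isometricSpace (P : ℝ≥0 → H →L[ℝ] H) :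
    IsClosed (isometricSpace P : Set H) := by
  have : (isometricSpace P : Set H) = ⋂ t, {f | (P t).adjoint (P t f) = f} := by
    ext f; simp [mem_isometricSpace]
  rw [this]
  exact isClosed_iInter fun t =>
    isClosed_eq ((P t).adjoint.continuous.comp (P t).continuous) continuous_id

theorem norm_adjoint_apply_le {A : H →L[ℝ] H} (hA : ∀ f, ‖A f‖ ≤ ‖f‖) (f : H) :
    ‖A.adjoint f‖ ≤ ‖f‖ := by
  have h1 : ‖A.adjoint‖ ≤ 1 := by
    rw [LinearIsometryEquiv.norm_map]
    exact A.opNorm_le_bound zero_le_one fun f => by simpa using hA f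
  simpa using A.adjoint.le_of_opNorm_le h1 f

theorem adjoint_apply_eq_self {A : H →L[ℝ] H} (hA : ∀ f, ‖A f‖ ≤ ‖f‖) {f : H} (hf : A f = f) :
    A.adjoint f = f := by
  refine (eq_of_inner_le (norm_adjoint_apply_le hA f) ?_).symm
  rw [ContinuousLinearMap.adjoint_inner_right, hf, real_inner_self_eq_norm_sq]

theorem norm_sub_adjoint_sq_le {A : H →L[ℝ] H} (hA : ∀ f, ‖A f‖ ≤ ‖f‖) (f : H) :
    ‖f - A.adjoint (A f)‖ ^ 2 ≤ ‖f‖ ^ 2 - ‖A f‖ ^ 2 := by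
  have h1 := norm_sub_sq_real f (A.adjoint (A f))
  rw [ContinuousLinearMap.adjoint_inner_right, real_inner_self_eq_norm_sq] at h1
  have h2 := norm_adjoint_apply_le hA (A f)
  nlinarith [norm_nonneg (A.adjoint (A f)), norm_nonneg (A f)]

theorem norm_sub_adjoint_apply_sq_le {A : H →L[ℝ] H} (hA : ∀ f, ‖A f‖ ≤ ‖f‖) (f : H) :
    ‖f - A.adjoint f‖ ^ 2 ≤ 2 * (‖f‖ * ‖f - A f‖) := by
  have h1 := norm_sub_sq_real f (A.adjoint f)
  rw [ContinuousLinearMap.adjoint_inner_right] at h1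
  have h2 := norm_adjoint_apply_le hA f
  have h3 := real_inner_le_norm (f - A f) f
  rw [inner_sub_left, real_inner_self_eq_norm_sq] at h3
  nlinarith [norm_nonneg (A.adjoint f), norm_nonneg f]

namespace IsContractionSemigroup

variable {P : ℝ≥0 → H →L[ℝ] H} (hP : IsContractionSemigroup P)
include hP

theorem mem_isometricSpace_iff_norm {f : H} : f ∈ isometricSpace P ↔ ∀ t, ‖P t f‖ = ‖f‖ := by
  refine ⟨fun h t => ?_, fun h t => ?_⟩
  · refine le_antisymm (hP.norm_le t f) ?_
    conv_lhs => rw [← h t]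
    exact norm_adjoint_apply_le (hP.norm_le t) _
  · have := norm_sub_adjoint_sq_le (hP.norm_le t) f
    rw [h t, sub_self] at this
    have h3 : ‖f - (P t).adjoint (P t f)‖ = 0 := by
      nlinarith [norm_nonneg (f - (P t).adjoint (P t f))]
    exact (sub_eq_zero.1 (norm_eq_zero.1 h3)).symm

theorem apply_mem_isometricSpace {f : H} (hf : f ∈ isometricSpace P) (s : ℝ≥0) :
    P s f ∈ isometricSpace P := by
  rw [hP.mem_isometricSpace_iff_norm] at hf ⊢
  intro t
  rw [← hP.add_apply, hf, hf]

theorem fixedSpace_le_isometricSpace : fixedSpace P ≤ isometricSpace P := fun f hf =>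
  hP.mem_isometricSpace_iff_norm.2 fun t => by rw [hf t]

theorem starProjection_apply (t : ℝ≥0) (f : H) :
    (fixedSpace P).starProjection (P t f) = (fixedSpace P).starProjection f := by
  refine Submodule.eq_starProjection_of_mem_of_inner_eq_zero
    (Submodule.starProjection_apply_mem _ _) fun w hw => ?_
  rw [inner_sub_left, ← ContinuousLinearMap.adjoint_inner_right,
    adjoint_apply_eq_self (hP.norm_le t) (hw t), ← inner_sub_left]
  exact Submodule.starProjection_inner_eq_zero f w hw

/-- The mean ergodic projection of `f` lies in every closed convex set containing the orbit. -/
theorem starProjection_mem {S : Set H} (hS : IsClosed S) (hconv : Convex ℝ S) {f : H}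
    (hf : ∀ t, P t f ∈ S) : (fixedSpace P).starProjection f ∈ S := by
  set C : Set H := closedConvexHull ℝ (Set.range fun t => P t f) with hC
  have hCclosed : IsClosed C := isClosed_closedConvexHull
  have hCconv : Convex ℝ C := convex_closedConvexHull
  have hCmin : ∀ S' : Set H, IsClosed S' → Convex ℝ S' → (∀ t, P t f ∈ S') → C ⊆ S' :=
    fun S' h1 h2 h3 => closedConvexHull_min (Set.range_subset_iff.2 h3) h2 h1
  have hCorb : ∀ t, P t f ∈ C := fun t => subset_closedConvexHull ⟨t, rfl⟩
  obtain ⟨z, hz, hzmin⟩ := exists_norm_eq_iInf_of_complete_convex ⟨_, hCorb 0⟩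
    hCclosed.isComplete hCconv (0 : H)
  rw [norm_eq_iInf_iff_real_inner_le_zero hCconv hz] at hzmin
  have hinv : ∀ s, ∀ w ∈ C, P s w ∈ C := fun s =>
    hCmin (P s ⁻¹' C) (hCclosed.preimage (P s).continuous)
      (hCconv.linear_preimage (P s : H →ₗ[ℝ] H)) fun t => by
        rw [Set.mem_preimage, ← hP.add_apply]; exact hCorb _
  have hzfix : ∀ s, P s z = z := fun s => by
    have h1 := hzmin _ (hinv s z hz)
    rw [zero_sub, inner_neg_left, inner_sub_right, real_inner_self_eq_norm_sq] at h1
    exact (eq_of_inner_le (hP.norm_le s z) (by linarith)).symm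
  have hE : ∀ w ∈ C, (fixedSpace P).starProjection w = (fixedSpace P).starProjection f :=
    hCmin {w | (fixedSpace P).starProjection w = (fixedSpace P).starProjection f}
      (isClosed_eq (ContinuousLinearMap.continuous _) continuous_const)
      ((convex_singleton _).linear_preimage ((fixedSpace P).starProjection : H →ₗ[ℝ] H))
      fun t => hP.starProjection_apply t f
  rw [← hE z hz, starProjection_fixedSpace_of_fixed hzfix]
  exact hCmin S hS hconv hf hz

omit [CompleteSpace H] in
theorem norm_apply_antitone (f : H) : Antitone fun t => ‖P t f‖ := fun s t hst => by
  obtain ⟨r, rfl⟩ := exists_add_of_le hst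
  change ‖P (s + r) f‖ ≤ ‖P s f‖
  rw [add_comm, hP.add_apply]
  exact hP.norm_le r _

/-- If all isometric vectors are fixed, then the semigroup converges weakly to the mean ergodic
projection. -/
theorem tendsto_inner (hiso : isometricSpace P ≤ fixedSpace P) (f g : H) :
    Tendsto (fun t => inner ℝ (P t f) g) atTop
      (nhds (inner ℝ ((fixedSpace P).starProjection f) g)) := by
  set E := (fixedSpace P).starProjection with hEdef
  -- vectors against which the orbit converges
  let W : Submodule ℝ H :=
    { carrier := {g | Tendsto (fun t => inner ℝ (P t (f - E f)) g) atTop (nhds 0)}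
      add_mem' := fun ha hb => by
        simpa only [Set.mem_ofPred_eq, inner_add_right, add_zero] using ha.add hb
      zero_mem' := by simp
      smul_mem' := fun c g hg => by
        simpa only [Set.mem_ofPred_eq, inner_smul_right, mul_zero] using hg.const_mul c }
  have hWclosed : IsClosed (W : Set H) := by
    rw [← isSeqClosed_iff_isClosed]
    intro x y hx hxy
    change Tendsto (fun t => inner ℝ (P t (f - E f)) y) atTop (nhds 0)
    rw [Metric.tendsto_atTop]
    intro ε hε
    have h0 : Tendsto (fun n => ‖f - E f‖ * ‖y - x n‖) atTop (nhds 0) := by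
      have : Tendsto (fun n => ‖y - x n‖) atTop (nhds 0) := by
        simpa using (tendsto_const_nhds.sub hxy).norm (a := y - y)
      simpa using this.const_mul ‖f - E f‖
    obtain ⟨n, hn⟩ := (h0.eventually (gt_mem_nhds (half_pos hε))).exists
    obtain ⟨N, hN⟩ := Metric.tendsto_atTop.1 (hx n) (ε / 2) (half_pos hε)
    refine ⟨N, fun t ht => ?_⟩
    have h1 := hN t ht
    rw [Real.dist_eq, sub_zero] at h1 ⊢
    have h2 := abs_real_inner_le_norm (P t (f - E f)) (y - x n)
    have h3 := hP.norm_le t (f - E f)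
    rw [inner_sub_right] at h2
    have h4 : ‖P t (f - E f)‖ * ‖y - x n‖ ≤ ‖f - E f‖ * ‖y - x n‖ := by gcongr
    have h5 := abs_sub_abs_le_abs_sub (inner ℝ (P t (f - E f)) y) (inner ℝ (P t (f - E f)) (x n))
    linarith
  have hWrange : ∀ s g, g - (P s).adjoint (P s g) ∈ W := by
    intro s g
    change Tendsto (fun t => inner ℝ (P t (f - E f)) (g - (P s).adjoint (P s g))) atTop (nhds 0)
    set u := f - E f
    have hlim := tendsto_atTop_ciInf (hP.norm_apply_antitone u)
      ⟨0, by rintro _ ⟨t, rfl⟩; exact norm_nonneg _⟩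
    have hlim2 : Tendsto (fun t => ‖P (s + t) u‖) atTop (nhds (⨅ t, ‖P t u‖)) :=
      hlim.comp (tendsto_atTop_mono (fun t => le_add_self) tendsto_id)
    have h0 : Tendsto (fun t => √(‖P t u‖ ^ 2 - ‖P (s + t) u‖ ^ 2) * ‖g‖) atTop (nhds 0) := by
      have := (((hlim.pow 2).sub (hlim2.pow 2)).sqrt).mul_const ‖g‖
      simpa using this
    refine squeeze_zero_norm (fun t => ?_) h0
    have h1 := norm_sub_adjoint_sq_le (hP.norm_le s) (P t u)
    rw [← hP.add_apply] at h1
    have h2 : inner ℝ (P t u) (g - (P s).adjoint (P s g))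
        = inner ℝ (P t u - (P s).adjoint (P (s + t) u)) g := by
      rw [inner_sub_right, inner_sub_left, ContinuousLinearMap.adjoint_inner_right,
        ContinuousLinearMap.adjoint_inner_left, hP.add_apply]
    rw [h2, Real.norm_eq_abs]
    refine (abs_real_inner_le_norm _ _).trans ?_
    gcongr
    exact Real.le_sqrt_of_sq_le h1
  have hWfix : fixedSpace P ≤ W := by
    intro g hg
    change Tendsto (fun t => inner ℝ (P t (f - E f)) g) atTop (nhds 0)
    have : ∀ t, inner ℝ (P t (f - E f)) g = (0 : ℝ) := fun t => by
      rw [← ContinuousLinearMap.adjoint_inner_right, adjoint_apply_eq_self (hP.norm_le t) (hg t)]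
      exact Submodule.starProjection_inner_eq_zero f g hg
    simpa only [this] using tendsto_const_nhds
  have hWtop : W = ⊤ := by
    have : CompleteSpace W := hWclosed.completeSpace_coe
    rw [← Submodule.orthogonal_eq_bot_iff, eq_bot_iff]
    intro g hg
    rw [Submodule.mem_orthogonal] at hg
    have hgiso : g ∈ isometricSpace P := fun s => by
      have h1 := hg _ (hWrange s g)
      have h2 := hg _ (hWrange s (g - (P s).adjoint (P s g)))
      have h4 : inner ℝ (g - (P s).adjoint (P s g)) (g - (P s).adjoint (P s g)) = (0 : ℝ) := by
        set d := g - (P s).adjoint (P s g) with hd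
        have : inner ℝ ((P s).adjoint (P s d)) g = inner ℝ d ((P s).adjoint (P s g)) := by
          rw [ContinuousLinearMap.adjoint_inner_left, ContinuousLinearMap.adjoint_inner_right]
        conv_lhs => arg 3; rw [hd]
        rw [inner_sub_right, ← this, ← inner_sub_left]
        exact h2
      exact (sub_eq_zero.1 (inner_self_eq_zero.1 h4)).symm
    exact inner_self_eq_zero.1 (hg g (hWfix (hiso hgiso)))
  have hg : g ∈ W := hWtop ▸ Submodule.mem_top
  have h1 : Tendsto (fun t => inner ℝ (P t (f - E f)) g) atTop (nhds 0) := hg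
  have h2 : ∀ t, inner ℝ (P t f) g = inner ℝ (P t (f - E f)) g + inner ℝ (E f) g := fun t => by
    rw [map_sub, apply_starProjection_fixedSpace, ← inner_add_left, sub_add_cancel]
  simp only [h2]
  simpa using h1.add_const (inner ℝ (E f) g)

end IsContractionSemigroup

end Hilbert

/-! ### The lattice structure of `L²` of a finite measure -/

section L2

variable {Ω : Type*} [MeasurableSpace Ω] {ν : Measure Ω}

theorem L2_inner_eq_integral (f g : Lp ℝ 2 ν) : inner ℝ f g = ∫ x, f x * g x ∂ν := by
  rw [L2.inner_def]
  simp [mul_comm]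

theorem L2_inner_nonneg {f g : Lp ℝ 2 ν} (hf : 0 ≤ f) (hg : 0 ≤ g) : 0 ≤ inner ℝ f g := by
  rw [L2_inner_eq_integral]
  refine integral_nonneg_of_ae ?_
  filter_upwards [(Lp.coeFn_nonneg f).2 hf, (Lp.coeFn_nonneg g).2 hg] with x h1 h2
  exact mul_nonneg h1 h2

theorem L2_inner_mono {f g h : Lp ℝ 2 ν} (hf : 0 ≤ f) (hgh : g ≤ h) :
    inner ℝ f g ≤ inner ℝ f h := by
  have := L2_inner_nonneg hf (sub_nonneg.2 hgh)
  rw [inner_sub_right] at this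
  linarith

theorem Lp_smul_nonneg {p : ℝ≥0∞} {c : ℝ} (hc : 0 ≤ c) {f : Lp ℝ p ν} (hf : 0 ≤ f) :
    0 ≤ c • f := by
  rw [← Lp.coeFn_nonneg] at hf ⊢
  filter_upwards [hf, Lp.coeFn_smul c f] with x h1 h2
  rw [h2]
  exact mul_nonneg hc h1

theorem Lp_smul_le_smul {p : ℝ≥0∞} {c : ℝ} (hc : 0 ≤ c) {f g : Lp ℝ p ν} (h : f ≤ g) :
    c • f ≤ c • g := by
  have := Lp_smul_nonneg hc (sub_nonneg.2 h)
  rwa [smul_sub, sub_nonneg] at this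

theorem L2_norm_sub_sq_le {f g : Lp ℝ 2 ν} (hf : 0 ≤ f) (hfg : f ≤ g) :
    ‖g - f‖ ^ 2 ≤ ‖g‖ ^ 2 - ‖f‖ ^ 2 := by
  have h1 := norm_sub_sq_real g f
  have h2 := L2_inner_mono hf hfg
  rw [real_inner_self_eq_norm_sq, real_inner_comm] at h2
  linarith

theorem L2_norm_le {f g : Lp ℝ 2 ν} (hf : 0 ≤ f) (hfg : f ≤ g) : ‖f‖ ≤ ‖g‖ := by
  have h1 := L2_norm_sub_sq_le hf hfg
  exact le_of_sq_le_sq (by nlinarith [sq_nonneg ‖g - f‖]) (norm_nonneg g)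

theorem L2_eq_of_norm_le {f g : Lp ℝ 2 ν} (hf : 0 ≤ f) (hfg : f ≤ g) (h : ‖g‖ ≤ ‖f‖) : f = g := by
  refine eq_of_inner_le h ?_
  have h2 := L2_inner_mono hf hfg
  rwa [real_inner_self_eq_norm_sq] at h2

theorem L2_exists_tendsto_of_antitone {w : ℝ≥0 → Lp ℝ 2 ν} (hw : Antitone w) (h0 : ∀ t, 0 ≤ w t) :
    ∃ v, Tendsto w atTop (nhds v) := by
  refine cauchySeq_tendsto_of_complete (Metric.cauchySeq_iff'.2 fun ε hε => ?_)
  have hmono : Antitone fun t => ‖w t‖ ^ 2 := fun s t hst => by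
    have := L2_norm_le (h0 t) (hw hst)
    change ‖w t‖ ^ 2 ≤ ‖w s‖ ^ 2
    gcongr
  have hbdd : BddBelow (Set.range fun t => ‖w t‖ ^ 2) :=
    ⟨0, by rintro _ ⟨t, rfl⟩; exact sq_nonneg _⟩
  have hlim := tendsto_atTop_ciInf hmono hbdd
  obtain ⟨N, hN⟩ := (hlim.eventually
    (gt_mem_nhds (lt_add_of_pos_right _ (pow_pos hε 2)))).exists
  refine ⟨N, fun t ht => ?_⟩
  rw [dist_comm, dist_eq_norm]
  have h1 := L2_norm_sub_sq_le (h0 t) (hw ht)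
  have h2 : (⨅ t, ‖w t‖ ^ 2) ≤ ‖w t‖ ^ 2 := ciInf_le hbdd t
  exact lt_of_pow_lt_pow_left₀ 2 hε.le (by linarith)

variable [IsFiniteMeasure ν]

variable (ν) in
/-- The constant function one as an element of `L²`. -/
def oneL2 : Lp ℝ 2 ν := Lp.const 2 ν (1 : ℝ)

theorem coeFn_oneL2 : (oneL2 ν : Ω → ℝ) =ᵐ[ν] fun _ => 1 := Lp.coeFn_const 2 ν (1 : ℝ)

theorem oneL2_nonneg : 0 ≤ oneL2 ν := by
  rw [← Lp.coeFn_nonneg]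
  filter_upwards [coeFn_oneL2 (ν := ν)] with x hx
  rw [hx]
  exact zero_le_one

theorem inner_oneL2_left (f : Lp ℝ 2 ν) : inner ℝ (oneL2 ν) f = ∫ x, f x ∂ν := by
  rw [L2_inner_eq_integral]
  refine integral_congr_ae ?_
  filter_upwards [coeFn_oneL2 (ν := ν)] with x hx
  rw [hx, one_mul]

theorem L2_integrable (f : Lp ℝ 2 ν) : Integrable f ν :=
  (Lp.memLp f).integrable one_le_two

theorem eq_zero_of_inner_oneL2_eq_zero {f : Lp ℝ 2 ν} (hf : 0 ≤ f)
    (h : inner ℝ (oneL2 ν) f = 0) : f = 0 := by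
  rw [inner_oneL2_left, integral_eq_zero_iff_of_nonneg_ae ((Lp.coeFn_nonneg f).2 hf)
    (L2_integrable f)] at h
  rwa [Lp.eq_zero_iff_ae_eq_zero]

theorem norm_sq_le_of_abs_le {f : Lp ℝ 2 ν} {c : ℝ} (hf : |f| ≤ c • oneL2 ν) :
    ‖f‖ ^ 2 ≤ c * inner ℝ (oneL2 ν) |f| := by
  have h1 := L2_inner_mono (abs_nonneg f) hf
  rw [real_inner_self_eq_norm_sq, norm_abs_eq_norm, inner_smul_right, real_inner_comm] at h1
  exact h1

/-- A strongly continuous semigroup of positive contractions on `L²` that preserves the constant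
function one. -/
structure IsMarkovSemigroup (P : ℝ≥0 → Lp ℝ 2 ν →L[ℝ] Lp ℝ 2 ν) : Prop extends
    IsContractionSemigroup P where
  nonneg : ∀ t f, 0 ≤ f → 0 ≤ P t f
  map_one : ∀ t, P t (oneL2 ν) = oneL2 ν

namespace IsMarkovSemigroup

variable {P : ℝ≥0 → Lp ℝ 2 ν →L[ℝ] Lp ℝ 2 ν} (hP : IsMarkovSemigroup P)
include hP

theorem mono (t : ℝ≥0) {f g : Lp ℝ 2 ν} (h : f ≤ g) : P t f ≤ P t g := by
  have := hP.nonneg t _ (sub_nonneg.2 h)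
  rwa [map_sub, sub_nonneg] at this

theorem abs_apply_le (t : ℝ≥0) (f : Lp ℝ 2 ν) : |P t f| ≤ P t |f| :=
  abs_le'.2 ⟨hP.mono t (le_abs_self f), by rw [← map_neg]; exact hP.mono t (neg_le_abs f)⟩

theorem abs_apply_le_smul_one {f : Lp ℝ 2 ν} {c : ℝ} (hf : |f| ≤ c • oneL2 ν) (t : ℝ≥0) :
    |P t f| ≤ c • oneL2 ν := by
  refine (hP.abs_apply_le t f).trans ((hP.mono t hf).trans ?_)
  rw [map_smul, hP.map_one]

theorem inner_one_apply (t : ℝ≥0) (f : Lp ℝ 2 ν) :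
    inner ℝ (oneL2 ν) (P t f) = inner ℝ (oneL2 ν) f := by
  rw [← ContinuousLinearMap.adjoint_inner_left,
    adjoint_apply_eq_self (hP.norm_le t) (hP.map_one t)]

theorem starProjection_nonneg {f : Lp ℝ 2 ν} (hf : 0 ≤ f) :
    0 ≤ (fixedSpace P).starProjection f := by
  refine hP.starProjection_mem (S := {g | 0 ≤ g}) isClosed_Ici ?_ fun t => hP.nonneg t f hf
  intro a ha b hb r s hr hs _
  exact add_nonneg (Lp_smul_nonneg hr ha) (Lp_smul_nonneg hs hb)

theorem starProjection_mono {f g : Lp ℝ 2 ν} (h : f ≤ g) :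
    (fixedSpace P).starProjection f ≤ (fixedSpace P).starProjection g := by
  have := hP.starProjection_nonneg (sub_nonneg.2 h)
  rwa [map_sub, sub_nonneg] at this

theorem starProjection_one : (fixedSpace P).starProjection (oneL2 ν) = oneL2 ν :=
  starProjection_fixedSpace_of_fixed hP.map_one

theorem starProjection_le_smul_one {f : Lp ℝ 2 ν} {c : ℝ} (hf : f ≤ c • oneL2 ν) :
    (fixedSpace P).starProjection f ≤ c • oneL2 ν := by
  have := hP.starProjection_mono hf
  rwa [map_smul, hP.starProjection_one] at this

theorem inner_one_starProjection (f : Lp ℝ 2 ν) :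
    inner ℝ (oneL2 ν) ((fixedSpace P).starProjection f) = inner ℝ (oneL2 ν) f := by
  rw [← Submodule.inner_starProjection_left_eq_right, hP.starProjection_one]

theorem abs_starProjection_le_smul_one {f : Lp ℝ 2 ν} {c : ℝ} (hf : |f| ≤ c • oneL2 ν) :
    |(fixedSpace P).starProjection f| ≤ c • oneL2 ν := by
  refine abs_le'.2 ⟨hP.starProjection_le_smul_one ((le_abs_self f).trans hf), ?_⟩
  rw [← map_neg]
  exact hP.starProjection_le_smul_one ((neg_le_abs f).trans hf)

/-- The semigroup acts on isometric vectors by lattice homomorphisms. -/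
theorem abs_apply_of_mem_isometricSpace {f : Lp ℝ 2 ν} (hf : f ∈ isometricSpace P) (t : ℝ≥0) :
    |P t f| = P t |f| := by
  refine L2_eq_of_norm_le (abs_nonneg _) (hP.abs_apply_le t f) ?_
  rw [norm_abs_eq_norm, hP.mem_isometricSpace_iff_norm.1 hf t]
  exact (hP.norm_le t _).trans_eq (norm_abs_eq_norm f)

theorem abs_mem_isometricSpace {f : Lp ℝ 2 ν} (hf : f ∈ isometricSpace P) :
    |f| ∈ isometricSpace P := by
  rw [hP.mem_isometricSpace_iff_norm]
  intro t
  rw [← hP.abs_apply_of_mem_isometricSpace hf, norm_abs_eq_norm, norm_abs_eq_norm,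
    hP.mem_isometricSpace_iff_norm.1 hf t]

theorem sup_mem_isometricSpace {f g : Lp ℝ 2 ν} (hf : f ∈ isometricSpace P)
    (hg : g ∈ isometricSpace P) : f ⊔ g ∈ isometricSpace P := by
  have h : f ⊔ g = (2⁻¹ : ℝ) • (f + g + |g - f|) := by
    rw [eq_inv_smul_iff₀ two_ne_zero, two_smul, ← two_nsmul, two_nsmul_sup_eq_add_add_abs_sub]
  rw [h]
  exact Submodule.smul_mem _ _ (Submodule.add_mem _ (Submodule.add_mem _ hf hg)
    (hP.abs_mem_isometricSpace (Submodule.sub_mem _ hg hf)))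

theorem inf_mem_isometricSpace {f g : Lp ℝ 2 ν} (hf : f ∈ isometricSpace P)
    (hg : g ∈ isometricSpace P) : f ⊓ g ∈ isometricSpace P := by
  rw [← neg_neg (f ⊓ g), neg_inf]
  exact Submodule.neg_mem _ (hP.sup_mem_isometricSpace (Submodule.neg_mem _ hf)
    (Submodule.neg_mem _ hg))

theorem one_mem_isometricSpace : oneL2 ν ∈ isometricSpace P :=
  hP.fixedSpace_le_isometricSpace hP.map_one

end IsMarkovSemigroup

end L2

/-! ### Dominated convergence in `L^p` -/

section Dominated

variable {Ω : Type*} [MeasurableSpace Ω] {m : Measure Ω}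

theorem Lp_tendsto_of_dominated {p : ℝ≥0∞} [hp1 : Fact (1 ≤ p)] (hp : p ≠ ∞) {F : ℕ → Lp ℝ p m}
    {f h : Lp ℝ p m} (hdom : ∀ n, |F n - f| ≤ |h|)
    (hlim : ∀ᵐ x ∂m, Tendsto (fun n => F n x) atTop (nhds (f x))) :
    Tendsto F atTop (nhds f) := by
  have hp0 : p ≠ 0 := (zero_lt_one.trans_le hp1.out).ne'
  have hpr : 0 < p.toReal := ENNReal.toReal_pos hp0 hp
  rw [Lp.tendsto_Lp_iff_tendsto_eLpNorm']
  simp_rw [eLpNorm_eq_lintegral_rpow_enorm_toReal hp0 hp]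
  have key : Tendsto (fun n => ∫⁻ x, ‖(F n - f : Ω → ℝ) x‖ₑ ^ p.toReal ∂m) atTop (nhds 0) := by
    have hz : ∫⁻ _ : Ω, (0 : ℝ≥0∞) ∂m = 0 := by simp
    rw [← hz]
    refine tendsto_lintegral_of_dominated_convergence' (fun x => ‖h x‖ₑ ^ p.toReal)
      (fun n => ?_) (fun n => ?_) ?_ ?_
    · exact (((Lp.aestronglyMeasurable _).sub
        (Lp.aestronglyMeasurable _)).enorm).pow_const _
    · filter_upwards [(Lp.coeFn_le _ _).2 (hdom n), Lp.coeFn_abs (F n - f), Lp.coeFn_abs h,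
        Lp.coeFn_sub (F n) f] with x h1 h2 h3 h4
      rw [h2, h3, h4] at h1
      gcongr
      exact enorm_le_iff_norm_le.2 h1
    · exact (lintegral_rpow_enorm_lt_top_of_eLpNorm_lt_top hp0 hp (Lp.eLpNorm_lt_top h)).ne
    · filter_upwards [hlim] with x hx
      have h1 : Tendsto (fun n => (F n - f : Ω → ℝ) x) atTop (nhds 0) := by
        simpa using hx.sub_const (f x)
      have h2 := (ENNReal.continuous_rpow_const (y := p.toReal)).tendsto 0 |>.comp
        (by simpa using h1.enorm)
      simpa [Function.comp_def, hpr] using h2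
  have := ((ENNReal.continuous_rpow_const (y := 1 / p.toReal)).tendsto 0).comp key
  simpa [Function.comp_def, hpr] using this

end Dominated

section Positivity

variable {Ω : Type*} [MeasurableSpace Ω] {ν : Measure Ω} [IsFiniteMeasure ν]
  {P : ℝ≥0 → Lp ℝ 2 ν →L[ℝ] Lp ℝ 2 ν}

/-- The indicator of the set where an isometric vector is positive is again isometric. -/
theorem IsMarkovSemigroup.exists_indicator_pos_mem_isometricSpace (hP : IsMarkovSemigroup P)
    {f : Lp ℝ 2 ν} (hf : f ∈ isometricSpace P) :
    ∃ χ ∈ isometricSpace P, (χ : Ω → ℝ) =ᵐ[ν] fun x => if 0 < f x then 1 else 0 := by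
  have hmeas : MemLp (fun x => if 0 < f x then (1 : ℝ) else 0) 2 ν := by
    have hs : MeasurableSet {x | 0 < f x} :=
      measurableSet_lt measurable_const (Lp.stronglyMeasurable f).measurable
    refine MemLp.of_bound (C := 1) ?_ (ae_of_all _ fun x => ?_)
    · exact (Measurable.ite hs measurable_const measurable_const).aestronglyMeasurable
    · split_ifs <;> simp
  refine ⟨hmeas.toLp _, ?_, hmeas.coeFn_toLp⟩
  set F : ℕ → Lp ℝ 2 ν := fun n => ((n : ℝ) • (f ⊔ 0)) ⊓ oneL2 ν with hF
  have hFmem : ∀ n, F n ∈ isometricSpace P := fun n =>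
    hP.inf_mem_isometricSpace (Submodule.smul_mem _ _
      (hP.sup_mem_isometricSpace hf (Submodule.zero_mem _))) hP.one_mem_isometricSpace
  have hFx : ∀ᵐ x ∂ν, ∀ n, F n x = min (n * max (f x) 0) 1 := by
    rw [ae_all_iff]
    intro n
    filter_upwards [Lp.coeFn_inf ((n : ℝ) • (f ⊔ 0)) (oneL2 ν), Lp.coeFn_smul (n : ℝ) (f ⊔ 0),
      Lp.coeFn_sup f 0, coeFn_oneL2 (ν := ν),
        AEEqFun.coeFn_zero (μ := ν) (β := ℝ)] with x h1 h2 h3 h4 h5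
    simp [hF, h1, h2, h3, h4, h5]
  refine (isClosed_isometricSpace P).mem_of_tendsto
    (Lp_tendsto_of_dominated (h := oneL2 ν) ENNReal.ofNat_ne_top (fun n => ?_) ?_)
    (Eventually.of_forall hFmem)
  · rw [abs_of_nonneg oneL2_nonneg, ← Lp.coeFn_le]
    filter_upwards [hFx, hmeas.coeFn_toLp, Lp.coeFn_abs (F n - hmeas.toLp _),
      Lp.coeFn_sub (F n) (hmeas.toLp _), coeFn_oneL2 (ν := ν)] with x h1 h2 h3 h4 h5
    rw [h3, h4, h5, Pi.sub_apply, h1, h2, abs_le]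
    have h6 : 0 ≤ (n : ℝ) * max (f x) 0 := by positivity
    have h7 : 0 ≤ min ((n : ℝ) * max (f x) 0) 1 := le_min h6 zero_le_one
    have h8 : min ((n : ℝ) * max (f x) 0) 1 ≤ 1 := min_le_right _ _
    split_ifs <;> constructor <;> linarith
  · filter_upwards [hFx, hmeas.coeFn_toLp] with x h1 h2
    simp_rw [h1, h2]
    split_ifs with h
    · obtain ⟨N, hN⟩ := exists_nat_gt (1 / f x)
      refine tendsto_const_nhds.congr' ?_
      filter_upwards [eventually_ge_atTop N] with n hn
      rw [max_eq_left h.le, min_eq_right]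
      rw [div_lt_iff₀ h] at hN
      have : (N : ℝ) ≤ n := by exact_mod_cast hn
      nlinarith
    · rw [max_eq_right (not_lt.1 h)]
      simp

end Positivity

/-! ### Bounded kernels dominated by an operator -/

section Kernel

variable {Ω : Type*} [MeasurableSpace Ω] {ν : Measure Ω} [IsFiniteMeasure ν]

/-- The integral operator with kernel `κ`, as an operation on functions. -/
def kernelInt (ν : Measure Ω) (κ : Ω → Ω → ℝ) (g : Ω → ℝ) (y : Ω) : ℝ := ∫ x, κ x y * g x ∂ν

/-- A measurable kernel with values in `[0, 1]`. -/
structure IsUnitKernel (κ : Ω → Ω → ℝ) : Prop where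
  measurable : Measurable (Function.uncurry κ)
  nonneg : ∀ x y, 0 ≤ κ x y
  le_one : ∀ x y, κ x y ≤ 1

/-- The operator `A` dominates the integral operator with kernel `κ` on bounded nonnegative
functions. -/
def KernelLE (κ : Ω → Ω → ℝ) (A : Lp ℝ 2 ν →L[ℝ] Lp ℝ 2 ν) : Prop :=
  ∀ g : Lp ℝ 2 ν, 0 ≤ g → (∃ c : ℝ, g ≤ c • oneL2 ν) → kernelInt ν κ g ≤ᵐ[ν] A g

namespace IsUnitKernel

variable {κ : Ω → Ω → ℝ} (hκ : IsUnitKernel κ)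
include hκ

theorem memLp_section (y : Ω) : MemLp (fun x => κ x y) 2 ν :=
  MemLp.of_bound (C := 1) (hκ.measurable.comp
    (measurable_id.prodMk measurable_const)).aestronglyMeasurable
    (ae_of_all _ fun x => by rw [Real.norm_eq_abs, abs_of_nonneg (hκ.nonneg x y)]
                             exact hκ.le_one x y)

theorem kernelInt_eq_inner (g : Lp ℝ 2 ν) (y : Ω) :
    kernelInt ν κ g y = inner ℝ ((hκ.memLp_section (ν := ν) y).toLp _) g := by
  rw [L2_inner_eq_integral]
  refine integral_congr_ae ?_
  filter_upwards [(hκ.memLp_section (ν := ν) y).coeFn_toLp] with x hx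
  rw [hx]

theorem section_nonneg (y : Ω) : 0 ≤ (hκ.memLp_section (ν := ν) y).toLp _ := by
  rw [← Lp.coeFn_nonneg]
  filter_upwards [(hκ.memLp_section (ν := ν) y).coeFn_toLp] with x hx
  rw [hx]
  exact hκ.nonneg x y

theorem section_le_one (y : Ω) : (hκ.memLp_section (ν := ν) y).toLp _ ≤ oneL2 ν := by
  rw [← Lp.coeFn_le]
  filter_upwards [(hκ.memLp_section (ν := ν) y).coeFn_toLp, coeFn_oneL2 (ν := ν)] with x hx h1
  rw [hx, h1]
  exact hκ.le_one x y

theorem kernelInt_nonneg {g : Lp ℝ 2 ν} (hg : 0 ≤ g) (y : Ω) : 0 ≤ kernelInt ν κ g y := by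
  rw [hκ.kernelInt_eq_inner]
  exact L2_inner_nonneg (hκ.section_nonneg y) hg

theorem kernelInt_mono {g h : Lp ℝ 2 ν} (hg : g ≤ h) (y : Ω) :
    kernelInt ν κ g y ≤ kernelInt ν κ h y := by
  rw [hκ.kernelInt_eq_inner, hκ.kernelInt_eq_inner]
  exact L2_inner_mono (hκ.section_nonneg y) hg

theorem kernelInt_add (g h : Lp ℝ 2 ν) (y : Ω) :
    kernelInt ν κ (g + h : Lp ℝ 2 ν) y = kernelInt ν κ g y + kernelInt ν κ h y := by
  simp_rw [hκ.kernelInt_eq_inner, inner_add_right]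

theorem kernelInt_sub (g h : Lp ℝ 2 ν) (y : Ω) :
    kernelInt ν κ (g - h : Lp ℝ 2 ν) y = kernelInt ν κ g y - kernelInt ν κ h y := by
  simp_rw [hκ.kernelInt_eq_inner, inner_sub_right]

theorem abs_kernelInt_le (g : Lp ℝ 2 ν) (y : Ω) : |kernelInt ν κ g y| ≤ ‖oneL2 ν‖ * ‖g‖ := by
  rw [hκ.kernelInt_eq_inner]
  refine (abs_real_inner_le_norm _ _).trans ?_
  gcongr
  exact L2_norm_le (hκ.section_nonneg y) (hκ.section_le_one y)

theorem stronglyMeasurable_kernelInt (g : Lp ℝ 2 ν) : StronglyMeasurable (kernelInt ν κ g) := by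
  refine StronglyMeasurable.integral_prod_right (f := fun y x => κ x y * g x) ?_
  refine (Measurable.mul ?_ ?_).stronglyMeasurable
  · exact hκ.measurable.comp measurable_swap
  · exact (Lp.stronglyMeasurable g).measurable.comp measurable_snd

theorem integrable_kernelInt (g : Lp ℝ 2 ν) : Integrable (kernelInt ν κ g) ν :=
  Integrable.of_bound (hκ.stronglyMeasurable_kernelInt g).aestronglyMeasurable _
    (ae_of_all _ fun y => hκ.abs_kernelInt_le g y)

/-- The adjoint of the integral operator applied to the indicator function of a set. -/
theorem exists_inner_eq_setIntegral_kernelInt (Y : Set Ω) :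
    ∃ ψ : Lp ℝ 2 ν, 0 ≤ ψ ∧ (∃ C : ℝ, 0 ≤ C ∧ ψ ≤ C • oneL2 ν) ∧
      ∀ g : Lp ℝ 2 ν, inner ℝ ψ g = ∫ y in Y, kernelInt ν κ g y ∂ν := by
  have hsm : StronglyMeasurable fun x => ∫ y in Y, κ x y ∂ν :=
    StronglyMeasurable.integral_prod_right (f := κ) hκ.measurable.stronglyMeasurable
  have hnn : ∀ x, 0 ≤ ∫ y in Y, κ x y ∂ν := fun x => integral_nonneg fun y => hκ.nonneg x y
  have hle : ∀ x, ∫ y in Y, κ x y ∂ν ≤ (ν.restrict Y).real Set.univ := fun x => by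
    have := norm_integral_le_of_norm_le_const (μ := ν.restrict Y) (f := κ x) (C := 1)
      (ae_of_all _ fun y => by
        rw [Real.norm_eq_abs, abs_of_nonneg (hκ.nonneg x y)]; exact hκ.le_one x y)
    rw [one_mul] at this
    exact (le_abs_self _).trans this
  have hmem : MemLp (fun x => ∫ y in Y, κ x y ∂ν) 2 ν :=
    MemLp.of_bound hsm.aestronglyMeasurable _ (ae_of_all _ fun x => by
      rw [Real.norm_eq_abs, abs_of_nonneg (hnn x)]; exact hle x)
  refine ⟨hmem.toLp _, ?_, ⟨(ν.restrict Y).real Set.univ, measureReal_nonneg, ?_⟩, fun g => ?_⟩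
  · rw [← Lp.coeFn_nonneg]
    filter_upwards [hmem.coeFn_toLp] with x hx
    rw [hx]
    exact hnn x
  · rw [← Lp.coeFn_le]
    filter_upwards [hmem.coeFn_toLp, coeFn_oneL2 (ν := ν),
      Lp.coeFn_smul ((ν.restrict Y).real Set.univ) (oneL2 ν)] with x hx h1 h2
    rw [hx, h2, Pi.smul_apply, h1, smul_eq_mul, mul_one]
    exact hle x
  · rw [L2_inner_eq_integral]
    have h1 : ∫ x, (hmem.toLp _ : Lp ℝ 2 ν) x * g x ∂ν
        = ∫ x, ∫ y in Y, κ x y * g x ∂ν ∂ν := by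
      refine integral_congr_ae ?_
      filter_upwards [hmem.coeFn_toLp] with x hx
      rw [hx, integral_mul_const]
    rw [h1, integral_integral_swap]
    · rfl
    have h2 : Integrable (fun z : Ω × Ω => g z.1) (ν.prod (ν.restrict Y)) :=
      (L2_integrable g).comp_fst (ν.restrict Y)
    refine h2.mono (hκ.measurable.aestronglyMeasurable.mul h2.aestronglyMeasurable)
      (ae_of_all _ fun z => ?_)
    change ‖κ z.1 z.2 * g z.1‖ ≤ ‖g z.1‖
    rw [norm_mul, Real.norm_eq_abs (κ z.1 z.2), abs_of_nonneg (hκ.nonneg _ _)]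
    exact mul_le_of_le_one_left (norm_nonneg _) (hκ.le_one _ _)

end IsUnitKernel

theorem KernelLE.ae_abs_apply_le {κ : Ω → Ω → ℝ} (hκ : IsUnitKernel κ)
    {A : Lp ℝ 2 ν →L[ℝ] Lp ℝ 2 ν} (hA : KernelLE κ A) {h : Lp ℝ 2 ν} {c : ℝ}
    (hc : |h| ≤ c • oneL2 ν) :
    ∀ᵐ y ∂ν, |A h y| ≤ |kernelInt ν κ h y| + A |h| y - kernelInt ν κ (|h| : Lp ℝ 2 ν) y := by
  have hbd : ∃ c : ℝ, |h| + |h| ≤ c • oneL2 ν :=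
    ⟨c + c, by rw [add_smul]; exact add_le_add hc hc⟩
  obtain ⟨d, hd⟩ := hbd
  have h1 := hA (|h| + h) (by rw [← neg_le_iff_add_nonneg]; exact neg_le_abs h)
    ⟨d, (add_le_add_right (le_abs_self h) _).trans hd⟩
  have h2 := hA (|h| - h) (sub_nonneg.2 (le_abs_self h))
    ⟨d, by rw [sub_eq_add_neg]; exact (add_le_add_right (neg_le_abs h) _).trans hd⟩
  rw [map_add] at h1
  rw [map_sub] at h2
  filter_upwards [h1, h2, Lp.coeFn_add (A |h|) (A h), Lp.coeFn_sub (A |h|) (A h)]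
    with y h3 h4 h5 h6
  rw [hκ.kernelInt_add, h5, Pi.add_apply] at h3
  rw [hκ.kernelInt_sub, h6, Pi.sub_apply] at h4
  rw [abs_le]
  constructor <;> linarith [le_abs_self (kernelInt ν κ h y), neg_le_abs (kernelInt ν κ h y)]

end Kernel

/-! ### Convergence of Markov semigroups dominating kernel operators -/

section Markov

variable {Ω : Type*} [MeasurableSpace Ω] {ν : Measure Ω} [IsFiniteMeasure ν]

/-- Every bounded nonzero nonnegative fixed vector is not annihilated by some integral operator
dominated by an operator of the semigroup. -/
def KernelSeesFixed (P : ℝ≥0 → Lp ℝ 2 ν →L[ℝ] Lp ℝ 2 ν) : Prop :=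
  ∀ h : Lp ℝ 2 ν, 0 ≤ h → (∃ c : ℝ, h ≤ c • oneL2 ν) → h ≠ 0 → (∀ t, P t h = h) →
    ∃ (t : ℝ≥0) (κ : Ω → Ω → ℝ), IsUnitKernel κ ∧ KernelLE κ (P t) ∧
      0 < ∫ y, kernelInt ν κ h y ∂ν

namespace IsMarkovSemigroup

variable {P : ℝ≥0 → Lp ℝ 2 ν →L[ℝ] Lp ℝ 2 ν} (hP : IsMarkovSemigroup P)
include hP

/-- A dominated kernel operator maps unimodular isometric vectors to unimodular multiples of the
image of the constant function one. -/
theorem ae_kernelInt_eq_or_eq_neg {σ : Lp ℝ 2 ν} (hσ : σ ∈ isometricSpace P)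
    (hσ1 : |σ| = oneL2 ν) {κ : Ω → Ω → ℝ} (hκ : IsUnitKernel κ) {t : ℝ≥0}
    (hle : KernelLE κ (P t)) :
    ∀ᵐ y ∂ν, kernelInt ν κ σ y = kernelInt ν κ (oneL2 ν) y ∨
      kernelInt ν κ σ y = -kernelInt ν κ (oneL2 ν) y := by
  have h1 : σ ≤ oneL2 ν := hσ1 ▸ le_abs_self σ
  have h2 : -σ ≤ oneL2 ν := hσ1 ▸ neg_le_abs σ
  have h3 := hle (oneL2 ν + σ) (by have := sub_nonneg.2 h2; rwa [sub_neg_eq_add] at this)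
    ⟨2, by rw [two_smul]; exact add_le_add_right h1 _⟩
  have h4 := hle (oneL2 ν - σ) (sub_nonneg.2 h1)
    ⟨2, by rw [two_smul, sub_eq_add_neg]; exact add_le_add_right h2 _⟩
  have h5 : |P t σ| = oneL2 ν := by
    rw [hP.abs_apply_of_mem_isometricSpace hσ, hσ1, hP.map_one]
  have h6 := Lp.coeFn_abs (P t σ)
  rw [h5] at h6
  rw [map_add, hP.map_one] at h3
  rw [map_sub, hP.map_one] at h4
  filter_upwards [h3, h4, h6, coeFn_oneL2 (ν := ν), Lp.coeFn_add (oneL2 ν) (P t σ),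
    Lp.coeFn_sub (oneL2 ν) (P t σ)] with y h7 h8 h9 h10 h11 h12
  have h13 := hκ.kernelInt_nonneg (sub_nonneg.2 h1) y
  have h14 := hκ.kernelInt_nonneg (sub_nonneg.2 h2) y
  rw [h11, Pi.add_apply, hκ.kernelInt_add, h10] at h7
  rw [h12, Pi.sub_apply, hκ.kernelInt_sub, h10] at h8
  rw [hκ.kernelInt_sub] at h13
  rw [sub_neg_eq_add, hκ.kernelInt_add] at h14
  rw [h10] at h9
  rcases eq_or_eq_neg_of_abs_eq h9.symm with h | h
  · left; rw [h] at h8; linarith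
  · right; rw [h] at h7; linarith

theorem abs_apply_le_oneL2 {σ : Lp ℝ 2 ν} (hσ1 : |σ| = oneL2 ν) (r : ℝ≥0) :
    |P r σ| ≤ oneL2 ν := by
  have := hP.abs_apply_le_smul_one (c := 1) (f := σ) (by rw [one_smul, hσ1]) r
  rwa [one_smul] at this

theorem starProjection_abs_sub_apply_double (σ : Lp ℝ 2 ν) (r : ℝ≥0) :
    (fixedSpace P).starProjection |σ - P (r + r) σ|
      ≤ (2 : ℝ) • (fixedSpace P).starProjection |σ - P r σ| := by
  have h1 : |σ - P (r + r) σ| ≤ |σ - P r σ| + P r |σ - P r σ| := by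
    have h2 : σ - P (r + r) σ = (σ - P r σ) + P r (σ - P r σ) := by
      rw [map_sub, hP.add_apply]; abel
    rw [h2]
    exact (abs_add_le _ _).trans (add_le_add_right (hP.abs_apply_le r _) _)
  have h3 := hP.starProjection_mono h1
  rw [map_add, hP.starProjection_apply] at h3
  rwa [two_smul]

theorem starProjection_abs_sub_apply_le (σ : Lp ℝ 2 ν) (s : ℝ≥0) (n : ℕ) :
    (fixedSpace P).starProjection |σ - P s σ|
      ≤ (2 ^ n : ℝ) • (fixedSpace P).starProjection |σ - P (s / 2 ^ n) σ| := by
  induction n with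
  | zero => simp
  | succ n ih =>
    have h1 : s / 2 ^ n = s / 2 ^ (n + 1) + s / 2 ^ (n + 1) := by
      rw [pow_succ, ← div_div, add_halves]
    have h2 := hP.starProjection_abs_sub_apply_double σ (s / 2 ^ (n + 1))
    rw [← h1] at h2
    refine ih.trans ((Lp_smul_le_smul (by positivity) h2).trans_eq ?_)
    rw [smul_smul, ← pow_succ]

theorem tendsto_norm_sub_adjoint_apply (k : Lp ℝ 2 ν) {τ : ℕ → ℝ≥0}
    (hτ : Tendsto τ atTop (nhds 0)) :
    Tendsto (fun n => ‖k - (P (τ n)).adjoint k‖) atTop (nhds 0) := by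
  have h3 : Tendsto (fun n => P (τ n) k) atTop (nhds k) := by
    have := (hP.continuous k).tendsto 0
    rw [hP.zero_apply] at this
    exact this.comp hτ
  have h4 : Tendsto (fun n => √(2 * (‖k‖ * ‖k - P (τ n) k‖))) atTop (nhds 0) := by
    have := ((((tendsto_const_nhds (x := k)).sub h3).norm.const_mul ‖k‖).const_mul 2).sqrt
    simpa using this
  exact squeeze_zero (fun n => norm_nonneg _)
    (fun n => Real.le_sqrt_of_sq_le (norm_sub_adjoint_apply_sq_le (hP.norm_le _) k)) h4

/-- The orbit of a unimodular isometric vector under a dominated kernel operator is, at almost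
every point, eventually invariant under small time shifts, uniformly along a countable set of
times. -/
theorem ae_exists_kernelInt_apply_add_eq {σ : Lp ℝ 2 ν} (hσ : σ ∈ isometricSpace P)
    (hσ1 : |σ| = oneL2 ν) {κ : Ω → Ω → ℝ} (hκ : IsUnitKernel κ) {t : ℝ≥0}
    (hle : KernelLE κ (P t)) (D : ℕ → ℝ≥0) {τ : ℕ → ℝ≥0} (hτ : Tendsto τ atTop (nhds 0)) :
    ∀ᵐ y ∂ν, ∃ N, ∀ n, N ≤ n → ∀ j,
      kernelInt ν κ (P (D j) σ) y = kernelInt ν κ (P (D j + τ n) σ) y := by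
  have hcases : ∀ r, ∀ᵐ y ∂ν, kernelInt ν κ (P r σ) y = kernelInt ν κ (oneL2 ν) y ∨
      kernelInt ν κ (P r σ) y = -kernelInt ν κ (oneL2 ν) y := fun r =>
    hP.ae_kernelInt_eq_or_eq_neg (hP.apply_mem_isometricSpace hσ r)
      (by rw [hP.abs_apply_of_mem_isometricSpace hσ, hσ1, hP.map_one]) hκ hle
  filter_upwards [ae_all_iff.2 fun j => hcases (D j),
    ae_all_iff.2 fun n => ae_all_iff.2 fun j => hcases (D j + τ n)] with y h1 h2
  rcases (hκ.kernelInt_nonneg (ν := ν) oneL2_nonneg y).eq_or_lt' with h0 | h0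
  · refine ⟨0, fun n _ j => ?_⟩
    have h3 := h1 j
    have h4 := h2 n j
    rw [h0, neg_zero, or_self] at h3 h4
    rw [h3, h4]
  · have hdiff : ∀ n j, |kernelInt ν κ (P (D j) σ) y - kernelInt ν κ (P (D j + τ n) σ) y|
        ≤ ‖(hκ.memLp_section (ν := ν) y).toLp _ -
          (P (τ n)).adjoint ((hκ.memLp_section (ν := ν) y).toLp _)‖ * ‖σ‖ := fun n j => by
      rw [hκ.kernelInt_eq_inner, hκ.kernelInt_eq_inner, add_comm, hP.add_apply,
        ← ContinuousLinearMap.adjoint_inner_left (P (τ n)), ← inner_sub_left]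
      refine (abs_real_inner_le_norm _ _).trans ?_
      gcongr
      exact hP.norm_le _ _
    have hsmall := (hP.tendsto_norm_sub_adjoint_apply
      ((hκ.memLp_section (ν := ν) y).toLp _) hτ).mul_const ‖σ‖
    rw [zero_mul] at hsmall
    obtain ⟨N, hN⟩ := eventually_atTop.1 (hsmall.eventually (gt_mem_nhds h0))
    refine ⟨N, fun n hn j => ?_⟩
    have h3 := (hdiff n j).trans_lt (hN n hn)
    rw [abs_lt] at h3
    rcases h1 j with h4 | h4 <;> rcases h2 n j with h5 | h5 <;> rw [h4, h5] at h3 ⊢ <;> linarith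

omit hP in
theorem kernelInt_abs_sub_eq_zero {κ : Ω → Ω → ℝ} (hκ : IsUnitKernel κ) {a b : Lp ℝ 2 ν}
    (ha : |a| ≤ oneL2 ν) (hb : |b| ≤ oneL2 ν) {y : Ω}
    (hab : kernelInt ν κ a y = kernelInt ν κ b y)
    (hay : kernelInt ν κ a y = kernelInt ν κ (oneL2 ν) y ∨
      kernelInt ν κ a y = -kernelInt ν κ (oneL2 ν) y) :
    kernelInt ν κ (|a - b| : Lp ℝ 2 ν) y = 0 := by
  have h2 : |a - b| ≤ (oneL2 ν - a) + (oneL2 ν - b) := by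
    refine abs_le'.2 ⟨?_, ?_⟩
    · have h3 : a ≤ oneL2 ν := (le_abs_self _).trans ha
      rw [← sub_nonneg]
      have : oneL2 ν - a + (oneL2 ν - b) - (a - b) = (2 : ℝ) • (oneL2 ν - a) := by
        rw [two_smul]; abel
      rw [this]
      exact Lp_smul_nonneg zero_le_two (sub_nonneg.2 h3)
    · have h3 : b ≤ oneL2 ν := (le_abs_self _).trans hb
      rw [← sub_nonneg]
      have : oneL2 ν - a + (oneL2 ν - b) - -(a - b) = (2 : ℝ) • (oneL2 ν - b) := by
        rw [two_smul]; abel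
      rw [this]
      exact Lp_smul_nonneg zero_le_two (sub_nonneg.2 h3)
  have h2' : |a - b| ≤ (oneL2 ν + a) + (oneL2 ν + b) := by
    refine abs_le'.2 ⟨?_, ?_⟩
    · have h3 : -b ≤ oneL2 ν := (neg_le_abs _).trans hb
      rw [← sub_nonneg]
      have : oneL2 ν + a + (oneL2 ν + b) - (a - b) = (2 : ℝ) • (oneL2 ν - -b) := by
        rw [two_smul]; abel
      rw [this]
      exact Lp_smul_nonneg zero_le_two (sub_nonneg.2 h3)
    · have h3 : -a ≤ oneL2 ν := (neg_le_abs _).trans ha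
      rw [← sub_nonneg]
      have : oneL2 ν + a + (oneL2 ν + b) - -(a - b) = (2 : ℝ) • (oneL2 ν - -a) := by
        rw [two_smul]; abel
      rw [this]
      exact Lp_smul_nonneg zero_le_two (sub_nonneg.2 h3)
  have h7 := hκ.kernelInt_mono h2 y
  have h8 := hκ.kernelInt_mono h2' y
  have h9 := hκ.kernelInt_nonneg (abs_nonneg (a - b)) y
  rw [hκ.kernelInt_add, hκ.kernelInt_sub, hκ.kernelInt_sub, ← hab] at h7
  rw [hκ.kernelInt_add, hκ.kernelInt_add, hκ.kernelInt_add, ← hab] at h8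
  rcases hay with h5 | h5 <;> rw [h5] at h7 h8 <;> linarith

/-- A vector whose orbit is orthogonal to `ψ` along a dense sequence of times has a mean
orthogonal to `ψ`. -/
theorem inner_starProjection_eq_zero_of_dense {ψ f : Lp ℝ 2 ν} {D : ℕ → ℝ≥0}
    (hD : DenseRange D) (h : ∀ j, inner ℝ ψ (P (D j) f) = 0) :
    inner ℝ ψ ((fixedSpace P).starProjection f) = 0 := by
  have horb' : ∀ r, inner ℝ ψ (P r f) = 0 := fun r => by
    have hcl : IsClosed {r | inner ℝ ψ (P r f) = 0} :=
      isClosed_eq (continuous_const.inner (hP.continuous _)) continuous_const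
    exact hD.induction_on r hcl h
  exact hP.starProjection_mem (S := {f | inner ℝ ψ f = 0})
    (isClosed_eq (continuous_const.inner continuous_id) continuous_const)
    (fun x hx y hy a b _ _ _ => by
      simp only [Set.mem_ofPred_eq] at hx hy ⊢
      rw [inner_add_right, inner_smul_right, inner_smul_right, hx, hy]; simp) horb'

/-- Unimodular isometric vectors are fixed. -/
theorem apply_eq_self_of_unimodular (hK : KernelSeesFixed P) {σ : Lp ℝ 2 ν}
    (hσ : σ ∈ isometricSpace P) (hσ1 : |σ| = oneL2 ν) (s : ℝ≥0) : P s σ = σ := by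
  by_contra hne
  obtain ⟨w, hw⟩ : ∃ w, w = (fixedSpace P).starProjection |σ - P s σ| := ⟨_, rfl⟩
  have hPσ := hP.abs_apply_le_oneL2 hσ1
  have hu2 : |σ - P s σ| ≤ (2 : ℝ) • oneL2 ν := by
    refine abs_le'.2 ⟨?_, ?_⟩ <;> rw [two_smul]
    · rw [sub_eq_add_neg]
      exact add_le_add (hσ1 ▸ le_abs_self σ) ((neg_le_abs _).trans (hPσ s))
    · rw [neg_sub, sub_eq_add_neg]
      exact add_le_add ((le_abs_self _).trans (hPσ s)) (hσ1 ▸ neg_le_abs σ)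
  have hw0 : 0 ≤ w := hw ▸ hP.starProjection_nonneg (abs_nonneg _)
  have hτ0 : Tendsto (fun n : ℕ => s / 2 ^ n) atTop (nhds 0) := by
    have h1 : Tendsto (fun n : ℕ => (2⁻¹ : ℝ≥0) ^ n) atTop (nhds 0) :=
      NNReal.tendsto_pow_atTop_nhds_zero_of_lt_one (by rw [← NNReal.coe_lt_coe]; norm_num)
    have h2 := (tendsto_const_nhds (x := s)).mul h1
    rw [mul_zero] at h2
    refine h2.congr fun n => ?_
    rw [inv_pow, div_eq_mul_inv]
  have hw_ne : w ≠ 0 := fun h0 => by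
    have h1 := hP.inner_one_starProjection |σ - P s σ|
    rw [← hw, h0, inner_zero_right] at h1
    have h2 := eq_zero_of_inner_oneL2_eq_zero (abs_nonneg _) h1.symm
    rw [← norm_eq_zero, norm_abs_eq_norm, norm_eq_zero, sub_eq_zero] at h2
    exact hne h2.symm
  obtain ⟨t, κ, hκ, hle, hpos⟩ := hK w hw0
    ⟨2, hw ▸ hP.starProjection_le_smul_one hu2⟩ hw_ne
    (fun t => hw ▸ apply_starProjection_fixedSpace P t _)
  have hcover := hP.ae_exists_kernelInt_apply_add_eq hσ hσ1 hκ hle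
    (TopologicalSpace.denseSeq ℝ≥0) hτ0
  have hdense := TopologicalSpace.denseRange_denseSeq ℝ≥0
  generalize TopologicalSpace.denseSeq ℝ≥0 = D at hcover hdense
  have hmeas : ∀ N, MeasurableSet {y | ∀ n, N ≤ n → ∀ j,
      kernelInt ν κ (P (D j) σ) y = kernelInt ν κ (P (D j + s / 2 ^ n) σ) y} := fun N => by
    simp only [Set.ofPred_forall]
    exact MeasurableSet.iInter fun n => MeasurableSet.iInter fun _ => MeasurableSet.iInter fun j =>
      measurableSet_eq_fun (hκ.stronglyMeasurable_kernelInt _).measurable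
        (hκ.stronglyMeasurable_kernelInt _).measurable
  have hzero : ∀ᵐ y ∂ν, kernelInt ν κ w y = 0 := by
    have h1 : ∀ N, ∀ᵐ y ∂ν, (∀ n, N ≤ n → ∀ j,
        kernelInt ν κ (P (D j) σ) y = kernelInt ν κ (P (D j + s / 2 ^ n) σ) y) →
        kernelInt ν κ w y = 0 := fun N => by
      obtain ⟨Y, hY⟩ : ∃ Y : Set Ω, Y = {y | ∀ n, N ≤ n → ∀ j,
        kernelInt ν κ (P (D j) σ) y = kernelInt ν κ (P (D j + s / 2 ^ n) σ) y} := ⟨_, rfl⟩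
      have hYmeas : MeasurableSet Y := hY ▸ hmeas N
      have hYmem : ∀ y, y ∈ Y ↔ ∀ n, N ≤ n → ∀ j,
          kernelInt ν κ (P (D j) σ) y = kernelInt ν κ (P (D j + s / 2 ^ n) σ) y := fun y => by
        rw [hY]; rfl
      simp_rw [← hYmem]
      obtain ⟨ψ, hψ0, -, hψ⟩ := hκ.exists_inner_eq_setIntegral_kernelInt (ν := ν) Y
      have horb : ∀ j, inner ℝ ψ (P (D j) |σ - P (s / 2 ^ N) σ|) = 0 := fun j => by
        have h1 : P (D j) |σ - P (s / 2 ^ N) σ| = |P (D j) σ - P (D j + s / 2 ^ N) σ| := by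
          rw [hP.add_apply, ← map_sub, hP.abs_apply_of_mem_isometricSpace]
          exact Submodule.sub_mem _ hσ (hP.apply_mem_isometricSpace hσ _)
        rw [hψ, h1]
        have h4 : ∀ᵐ y ∂(ν.restrict Y), kernelInt ν κ
            (|P (D j) σ - P (D j + s / 2 ^ N) σ| : Lp ℝ 2 ν) y = 0 := by
          rw [ae_restrict_iff' hYmeas]
          filter_upwards [hP.ae_kernelInt_eq_or_eq_neg (hP.apply_mem_isometricSpace hσ (D j))
            (by rw [hP.abs_apply_of_mem_isometricSpace hσ, hσ1, hP.map_one]) hκ hle] with y h5 hy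
          exact kernelInt_abs_sub_eq_zero hκ (hPσ _) (hPσ _) ((hYmem y).1 hy N le_rfl j) h5
        rw [integral_congr_ae h4, integral_zero]
      have h2 := L2_inner_mono hψ0 (hP.starProjection_abs_sub_apply_le σ s N)
      rw [inner_smul_right, hP.inner_starProjection_eq_zero_of_dense hdense horb, mul_zero,
        ← hw] at h2
      have h3 := (hψ w).symm.trans (le_antisymm h2 (L2_inner_nonneg hψ0 hw0))
      rw [← ae_restrict_iff' hYmeas]
      exact (integral_eq_zero_iff_of_nonneg (fun y => hκ.kernelInt_nonneg hw0 y)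
        (hκ.integrable_kernelInt _).integrableOn).1 h3
    filter_upwards [ae_all_iff.2 h1, hcover] with y h2 ⟨N, hN⟩
    exact h2 N hN
  rw [integral_congr_ae hzero, integral_zero] at hpos
  exact hpos.false

/-- Isometric vectors are fixed. -/
theorem isometricSpace_le_fixedSpace (hK : KernelSeesFixed P) :
    isometricSpace P ≤ fixedSpace P := by
  have hsign : ∀ f ∈ isometricSpace P, ∃ χ : Lp ℝ 2 ν, (∀ t, P t χ = χ) ∧
      (χ : Ω → ℝ) =ᵐ[ν] fun x => if 0 < f x then 1 else 0 := fun f hf => by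
    obtain ⟨χ, hχ, hχf⟩ := hP.exists_indicator_pos_mem_isometricSpace hf
    refine ⟨χ, fun t => ?_, hχf⟩
    have h1 : |(2 : ℝ) • χ - oneL2 ν| = oneL2 ν := by
      refine Lp.ext ?_
      filter_upwards [hχf, coeFn_oneL2 (ν := ν), Lp.coeFn_abs ((2 : ℝ) • χ - oneL2 ν),
        Lp.coeFn_sub ((2 : ℝ) • χ) (oneL2 ν), Lp.coeFn_smul (2 : ℝ) χ] with x h1 h2 h3 h4 h5
      rw [h3, h4, Pi.sub_apply, h5, Pi.smul_apply, h1, h2]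
      split_ifs <;> norm_num
    have h2 := hP.apply_eq_self_of_unimodular hK (Submodule.sub_mem _
      (Submodule.smul_mem _ 2 hχ) hP.one_mem_isometricSpace) h1 t
    rw [map_sub, map_smul, hP.map_one, sub_left_inj] at h2
    exact smul_right_injective _ two_ne_zero h2
  have hle : ∀ g ∈ isometricSpace P, (fixedSpace P).starProjection g = 0 → g ≤ 0 :=
    fun g hg h0 => by
      obtain ⟨χ, hχ, hχg⟩ := hsign g hg
      have h1 : inner ℝ χ g = 0 := by
        rw [← starProjection_fixedSpace_of_fixed hχ,
          Submodule.inner_starProjection_left_eq_right, h0, inner_zero_right]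
      rw [L2_inner_eq_integral] at h1
      have h2 : (fun x => χ x * g x) =ᵐ[ν] fun x => max (g x) 0 := by
        filter_upwards [hχg] with x hx
        rw [hx]
        split_ifs with h
        · rw [one_mul, max_eq_left h.le]
        · rw [zero_mul, max_eq_right (not_lt.1 h)]
      rw [integral_congr_ae h2] at h1
      have h1 := (integral_eq_zero_iff_of_nonneg (f := fun x => max (g x) 0)
        (fun x => le_max_right _ _) (L2_integrable g).pos_part).1 h1
      rw [← Lp.coeFn_le]
      filter_upwards [h1, Lp.coeFn_zero ℝ 2 ν] with x h3 h4
      rw [h4]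
      exact max_eq_right_iff.1 h3
  intro f hf
  set g := f - (fixedSpace P).starProjection f with hg
  have hgiso : g ∈ isometricSpace P := Submodule.sub_mem _ hf
    (hP.fixedSpace_le_isometricSpace (Submodule.starProjection_apply_mem _ _))
  have hE : (fixedSpace P).starProjection g = 0 := by
    rw [hg, map_sub, starProjection_fixedSpace_of_fixed
      (fun t => apply_starProjection_fixedSpace P t f), sub_self]
  have h1 := hle g hgiso hE
  have h2 := hle (-g) (Submodule.neg_mem _ hgiso) (by rw [map_neg, hE, neg_zero])
  have h3 : g = 0 := le_antisymm h1 (neg_nonpos.1 h2)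
  rw [sub_eq_zero.1 h3]
  exact Submodule.starProjection_apply_mem _ _

end IsMarkovSemigroup

end Markov

/-! ### Strong convergence of Markov semigroups dominating kernel operators -/

namespace IsMarkovSemigroup

variable {Ω : Type*} [MeasurableSpace Ω] {ν : Measure Ω} [IsFiniteMeasure ν]
  {P : ℝ≥0 → Lp ℝ 2 ν →L[ℝ] Lp ℝ 2 ν} (hP : IsMarkovSemigroup P)
include hP

theorem abs_apply_add_le (s t : ℝ≥0) (g : Lp ℝ 2 ν) : |P (s + t) g| ≤ P s |P t g| := by
  rw [hP.add_apply]
  exact hP.abs_apply_le s _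

theorem antitone_starProjection_abs_apply (g : Lp ℝ 2 ν) :
    Antitone fun t => (fixedSpace P).starProjection |P t g| := fun s t hst => by
  obtain ⟨r, rfl⟩ := exists_add_of_le hst
  have := hP.starProjection_mono (hP.abs_apply_add_le r s g)
  rwa [hP.starProjection_apply, add_comm] at this

theorem tendsto_inner_one_abs_apply {g v : Lp ℝ 2 ν}
    (hv : Tendsto (fun t => (fixedSpace P).starProjection |P t g|) atTop (nhds v)) :
    Tendsto (fun t => inner ℝ (oneL2 ν) |P t g|) atTop (nhds (inner ℝ (oneL2 ν) v)) :=
  ((tendsto_const_nhds (x := oneL2 ν)).inner hv).congr fun _ => hP.inner_one_starProjection _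

theorem tendsto_integral_abs_kernelInt (hiso : isometricSpace P ≤ fixedSpace P)
    {g : Lp ℝ 2 ν} (hg : (fixedSpace P).starProjection g = 0) {κ : Ω → Ω → ℝ}
    (hκ : IsUnitKernel κ) :
    Tendsto (fun t => ∫ y, |kernelInt ν κ (P t g) y| ∂ν) atTop (nhds 0) := by
  have hz : ∫ _ : Ω, (0 : ℝ) ∂ν = 0 := by simp
  rw [← hz]
  refine tendsto_integral_filter_of_dominated_convergence (fun _ => ‖oneL2 ν‖ * ‖g‖)
    (Eventually.of_forall fun _ => ?_) (Eventually.of_forall fun t => ae_of_all _ fun y => ?_)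
    (integrable_const _) (ae_of_all _ fun y => ?_)
  · exact (hκ.integrable_kernelInt _).abs.aestronglyMeasurable
  · rw [Real.norm_eq_abs, abs_abs]
    refine (hκ.abs_kernelInt_le _ y).trans ?_
    gcongr
    exact hP.norm_le t g
  · have h1 := hP.tendsto_inner hiso g ((hκ.memLp_section (ν := ν) y).toLp _)
    rw [hg, inner_zero_left] at h1
    have h2 := h1.abs
    rw [abs_zero] at h2
    refine h2.congr fun t => ?_
    rw [hκ.kernelInt_eq_inner, real_inner_comm]

theorem integral_kernelInt_abs_apply_le {g : Lp ℝ 2 ν} {c : ℝ} (hc : |g| ≤ c • oneL2 ν)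
    {κ : Ω → Ω → ℝ} (hκ : IsUnitKernel κ) {s : ℝ≥0} (hle : KernelLE κ (P s)) (t : ℝ≥0) :
    ∫ y, kernelInt ν κ (|P t g| : Lp ℝ 2 ν) y ∂ν ≤ ∫ y, |kernelInt ν κ (P t g) y| ∂ν +
      (inner ℝ (oneL2 ν) |P t g| - inner ℝ (oneL2 ν) |P (s + t) g|) := by
  have h1 := hle.ae_abs_apply_le hκ (hP.abs_apply_le_smul_one hc t)
  have h2 : ∫ y, |P s (P t g) y| ∂ν ≤ ∫ y, (|kernelInt ν κ (P t g) y| + P s |P t g| y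
      - kernelInt ν κ (|P t g| : Lp ℝ 2 ν) y) ∂ν :=
    integral_mono_ae (L2_integrable _).abs
      (((hκ.integrable_kernelInt _).abs.add (L2_integrable _)).sub (hκ.integrable_kernelInt _)) h1
  have hintg : Integrable (fun y => |kernelInt ν κ (P t g) y| + P s |P t g| y) ν :=
    (hκ.integrable_kernelInt _).abs.add (L2_integrable _)
  rw [integral_sub hintg (hκ.integrable_kernelInt _),
      integral_add (hκ.integrable_kernelInt _).abs (L2_integrable _),
    ← inner_oneL2_left (P s |P t g|), hP.inner_one_apply] at h2
  have h3 : ∫ y, |P s (P t g) y| ∂ν = inner ℝ (oneL2 ν) |P (s + t) g| := by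
    rw [inner_oneL2_left, hP.add_apply]
    exact integral_congr_ae (Lp.coeFn_abs _).symm
  rw [h3] at h2
  linarith

omit hP in
theorem tendsto_const_add_atTop (r : ℝ≥0) : Tendsto (fun t => r + t) atTop atTop :=
  tendsto_atTop_mono (fun _ => le_add_self) tendsto_id

theorem tendsto_apply_zero (hK : KernelSeesFixed P) {g : Lp ℝ 2 ν} {c : ℝ}
    (hc : |g| ≤ c • oneL2 ν) (hg : (fixedSpace P).starProjection g = 0) :
    Tendsto (fun t => P t g) atTop (nhds 0) := by
  have hiso := hP.isometricSpace_le_fixedSpace hK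
  have hanti := hP.antitone_starProjection_abs_apply g
  obtain ⟨v, hv⟩ := L2_exists_tendsto_of_antitone hanti
    fun t => hP.starProjection_nonneg (abs_nonneg _)
  have hβ := hP.tendsto_inner_one_abs_apply hv
  suffices hv0 : v = 0 by
    rw [hv0, inner_zero_right] at hβ
    have h1 := hβ.const_mul c
    rw [mul_zero] at h1
    have h2 : Tendsto (fun t => ‖P t g‖ ^ 2) atTop (nhds 0) :=
      squeeze_zero (fun t => by positivity)
        (fun t => norm_sq_le_of_abs_le (hP.abs_apply_le_smul_one hc t)) h1
    have h3 := h2.sqrt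
    simp only [Real.sqrt_sq (norm_nonneg _), Real.sqrt_zero] at h3
    exact tendsto_zero_iff_norm_tendsto_zero.2 h3
  by_contra hne
  have hvle : ∀ t, v ≤ (fixedSpace P).starProjection |P t g| := hanti.le_of_tendsto hv
  have hv0 : 0 ≤ v := ge_of_tendsto hv
    (Eventually.of_forall fun t => hP.starProjection_nonneg (abs_nonneg _))
  have hvc : v ≤ c • oneL2 ν := (hvle 0).trans
    (hP.starProjection_le_smul_one (hP.abs_apply_le_smul_one hc 0))
  have hvfix : v ∈ fixedSpace P := (isClosed_fixedSpace P).mem_of_tendsto hv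
    (Eventually.of_forall fun t => Submodule.starProjection_apply_mem _ _)
  obtain ⟨t₀, κ, hκ, hle, hpos⟩ := hK v hv0 ⟨c, hvc⟩ hne hvfix
  obtain ⟨ψ, hψ0, ⟨C, hC0, hψC⟩, hψ⟩ :=
    hκ.exists_inner_eq_setIntegral_kernelInt (ν := ν) Set.univ
  simp only [Measure.restrict_univ] at hψ
  rw [← hψ] at hpos
  set b := inner ℝ (oneL2 ν) v with hb
  have hshift : ∀ r, Tendsto (fun t => inner ℝ (oneL2 ν) |P (r + t) g|) atTop (nhds b) :=
    fun r => hβ.comp (tendsto_const_add_atTop r)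
  have hψu : Tendsto (fun t => ∫ y, |kernelInt ν κ (P t g) y| ∂ν +
      (inner ℝ (oneL2 ν) |P t g| - inner ℝ (oneL2 ν) |P (t₀ + t) g|)) atTop (nhds 0) := by
    have := (hP.tendsto_integral_abs_kernelInt hiso hg hκ).add (hβ.sub (hshift t₀))
    rwa [sub_self, add_zero] at this
  have hstep : ∀ t, inner ℝ ψ ((fixedSpace P).starProjection |P t g|)
      ≤ C * (inner ℝ (oneL2 ν) |P t g| - b) := fun t => by
    have h1 : Tendsto (fun s => inner ℝ ψ (P s |P t g|)) atTop
        (nhds (inner ℝ ψ ((fixedSpace P).starProjection |P t g|))) := by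
      have := hP.tendsto_inner hiso |P t g| ψ
      simpa only [real_inner_comm] using this
    have h2 : Tendsto (fun s => (∫ y, |kernelInt ν κ (P (t + s) g) y| ∂ν +
        (inner ℝ (oneL2 ν) |P (t + s) g| - inner ℝ (oneL2 ν) |P (t₀ + (t + s)) g|)) +
        C * (inner ℝ (oneL2 ν) |P t g| - inner ℝ (oneL2 ν) |P (t + s) g|)) atTop
        (nhds (0 + C * (inner ℝ (oneL2 ν) |P t g| - b))) :=
      (hψu.comp (tendsto_const_add_atTop t)).add
        ((tendsto_const_nhds.sub (hshift t)).const_mul C)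
    rw [zero_add] at h2
    refine le_of_tendsto_of_tendsto' h1 h2 fun s => ?_
    have h3 := hP.integral_kernelInt_abs_apply_le hc hκ hle (t + s)
    rw [← hψ] at h3
    have h4 : 0 ≤ P s |P t g| - |P (t + s) g| := by
      rw [sub_nonneg, add_comm]
      exact hP.abs_apply_add_le s t g
    have h5 := L2_inner_mono h4 hψC
    rw [real_inner_comm, inner_smul_right, real_inner_comm (oneL2 ν), inner_sub_right,
      inner_sub_right, hP.inner_one_apply] at h5
    linarith
  have hlim : Tendsto (fun t => C * (inner ℝ (oneL2 ν) |P t g| - b)) atTop (nhds 0) := by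
    have := (hβ.sub_const b).const_mul C
    rwa [sub_self, mul_zero] at this
  exact hpos.not_ge (ge_of_tendsto hlim
    (Eventually.of_forall fun t => (L2_inner_mono hψ0 (hvle t)).trans (hstep t)))

/-- Orbits of bounded functions converge to their mean ergodic projection. -/
theorem tendsto_apply (hK : KernelSeesFixed P) {f : Lp ℝ 2 ν} {c : ℝ} (hc : |f| ≤ c • oneL2 ν) :
    Tendsto (fun t => P t f) atTop (nhds ((fixedSpace P).starProjection f)) := by
  have h1 := hP.tendsto_apply_zero hK (g := f - (fixedSpace P).starProjection f) (c := c + c)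
    (by
      rw [sub_eq_add_neg, add_smul]
      refine (abs_add_le _ _).trans (add_le_add hc ?_)
      rw [abs_neg]
      exact hP.abs_starProjection_le_smul_one hc)
    (by rw [map_sub, starProjection_fixedSpace_of_fixed
          (fun t => apply_starProjection_fixedSpace P t f), sub_self])
  rw [← tendsto_sub_nhds_zero_iff]
  refine h1.congr fun t => ?_
  rw [map_sub, apply_starProjection_fixedSpace]

end IsMarkovSemigroup

/-! ### Change of density -/

section Weighted

variable {Ω : Type*} [MeasurableSpace Ω] {μ : Measure Ω} {p : ℝ≥0∞}

/-- The measure with density `f₀ ^ p` with respect to `μ`. -/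
def weightedMeasure (f₀ : Lp ℝ p μ) : Measure Ω :=
  μ.withDensity fun x => ((f₀ x ^ p.toReal).toNNReal : ℝ≥0∞)

theorem measurable_weight (f₀ : Lp ℝ p μ) :
    Measurable fun x => (f₀ x ^ p.toReal).toNNReal :=
  ((Lp.stronglyMeasurable f₀).measurable.pow_const _).real_toNNReal

theorem ae_weightedMeasure_of_ae (f₀ : Lp ℝ p μ) {Q : Ω → Prop} (h : ∀ᵐ x ∂μ, Q x) :
    ∀ᵐ x ∂(weightedMeasure f₀), Q x :=
  (withDensity_absolutelyContinuous μ _).ae_le h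

theorem ae_of_ae_weightedMeasure {f₀ : Lp ℝ p μ} (hf₀ : ∀ᵐ x ∂μ, 0 < f₀ x) {Q : Ω → Prop}
    (h : ∀ᵐ x ∂(weightedMeasure f₀), Q x) : ∀ᵐ x ∂μ, Q x := by
  refine (withDensity_absolutelyContinuous' (measurable_weight f₀).coe_nnreal_ennreal.aemeasurable
    ?_).ae_le h
  filter_upwards [hf₀] with x hx
  simpa using Real.rpow_pos_of_pos hx _

theorem integral_weightedMeasure {f₀ : Lp ℝ p μ} (hf₀ : ∀ᵐ x ∂μ, 0 < f₀ x) (g : Ω → ℝ) :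
    ∫ x, g x ∂(weightedMeasure f₀) = ∫ x, f₀ x ^ p.toReal * g x ∂μ := by
  rw [weightedMeasure, integral_withDensity_eq_integral_smul (measurable_weight f₀)]
  refine integral_congr_ae ?_
  filter_upwards [hf₀] with x hx
  rw [NNReal.smul_def, Real.coe_toNNReal _ (Real.rpow_nonneg hx.le _), smul_eq_mul]

theorem eLpNorm_div_weightedMeasure [hp1 : Fact (1 ≤ p)] (hp : p ≠ ∞) {f₀ : Lp ℝ p μ}
    (hf₀ : ∀ᵐ x ∂μ, 0 < f₀ x) (f : Ω → ℝ) :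
    eLpNorm (fun x => f x / f₀ x) p (weightedMeasure f₀) = eLpNorm f p μ := by
  have hp0 : p ≠ 0 := (zero_lt_one.trans_le hp1.out).ne'
  rw [eLpNorm_eq_lintegral_rpow_enorm_toReal hp0 hp, eLpNorm_eq_lintegral_rpow_enorm_toReal hp0 hp,
    weightedMeasure, lintegral_withDensity_eq_lintegral_mul_non_measurable _
      (measurable_weight f₀).coe_nnreal_ennreal (ae_of_all _ fun x => ENNReal.coe_lt_top)]
  congr 1
  refine lintegral_congr_ae ?_
  filter_upwards [hf₀] with x hx
  simp only [Pi.mul_apply, Real.enorm_eq_ofReal_abs]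
  rw [ENNReal.ofReal_rpow_of_nonneg (abs_nonneg _) ENNReal.toReal_nonneg,
    ENNReal.ofReal_rpow_of_nonneg (abs_nonneg _) ENNReal.toReal_nonneg]
  change ENNReal.ofReal _ * _ = _
  rw [← ENNReal.ofReal_mul (Real.rpow_nonneg hx.le _), abs_div, abs_of_pos hx,
    ← Real.mul_rpow hx.le (by positivity), mul_div_cancel₀ _ hx.ne']

theorem isFiniteMeasure_weightedMeasure [hp1 : Fact (1 ≤ p)] (hp : p ≠ ∞) {f₀ : Lp ℝ p μ}
    (hf₀ : ∀ᵐ x ∂μ, 0 < f₀ x) : IsFiniteMeasure (weightedMeasure f₀) := by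
  have hp0 : p ≠ 0 := (zero_lt_one.trans_le hp1.out).ne'
  refine isFiniteMeasure_withDensity ?_
  refine ne_of_eq_of_ne (lintegral_congr_ae ?_)
    (lintegral_rpow_enorm_lt_top_of_eLpNorm_lt_top hp0 hp (Lp.eLpNorm_lt_top f₀)).ne
  filter_upwards [hf₀] with x hx
  rw [Real.enorm_eq_ofReal_abs, ENNReal.ofReal_rpow_of_nonneg (abs_nonneg _) ENNReal.toReal_nonneg,
    abs_of_pos hx]
  rfl

/-- The functions bounded by a multiple of `f₀`. -/
def boundedBy [Fact (1 ≤ p)] (f₀ : Lp ℝ p μ) : Submodule ℝ (Lp ℝ p μ) where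
  carrier := {f | ∃ c : ℝ, |f| ≤ c • f₀}
  add_mem' := by
    rintro f g ⟨c, hc⟩ ⟨d, hd⟩
    exact ⟨c + d, by rw [add_smul]; exact (abs_add_le _ _).trans (add_le_add hc hd)⟩
  zero_mem' := ⟨0, by simp⟩
  smul_mem' := by
    rintro a f ⟨c, hc⟩
    refine ⟨|a| * c, ?_⟩
    have h1 : |a • f| = |a| • |f| := by
      refine Lp.ext ?_
      filter_upwards [Lp.coeFn_abs (a • f), Lp.coeFn_smul a f, Lp.coeFn_smul |a| |f|,
        Lp.coeFn_abs f] with x h1 h2 h3 h4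
      simp [h1, h2, h3, h4, abs_mul]
    rw [h1, mul_smul]
    exact Lp_smul_le_smul (abs_nonneg a) hc

theorem ae_abs_le_of_abs_le_smul {f f₀ : Lp ℝ p μ} {c : ℝ} (h : |f| ≤ c • f₀) :
    ∀ᵐ x ∂μ, |f x| ≤ c * f₀ x := by
  filter_upwards [(Lp.coeFn_le _ _).2 h, Lp.coeFn_abs f, Lp.coeFn_smul c f₀] with x h1 h2 h3
  rwa [h2, h3] at h1

theorem abs_le_smul_of_ae {f f₀ : Lp ℝ p μ} {c : ℝ} (h : ∀ᵐ x ∂μ, |f x| ≤ c * f₀ x) :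
    |f| ≤ c • f₀ := by
  rw [← Lp.coeFn_le]
  filter_upwards [h, Lp.coeFn_abs f, Lp.coeFn_smul c f₀] with x h1 h2 h3
  rw [h2, h3]
  exact h1

theorem ae_abs_div_le {f₀ : Lp ℝ p μ} (hf₀ : ∀ᵐ x ∂μ, 0 < f₀ x) {f : Lp ℝ p μ} {c : ℝ}
    (h : |f| ≤ c • f₀) :
    ∀ᵐ x ∂(weightedMeasure f₀), |f x / f₀ x| ≤ c := by
  refine ae_weightedMeasure_of_ae f₀ ?_
  filter_upwards [hf₀, ae_abs_le_of_abs_le_smul h] with x h1 h2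
  rwa [abs_div, abs_of_pos h1, div_le_iff₀ h1]

theorem aestronglyMeasurable_div (f₀ f : Lp ℝ p μ) (m : Measure Ω) :
    AEStronglyMeasurable (fun x => f x / f₀ x) m :=
  ((Lp.stronglyMeasurable f).measurable.div
    (Lp.stronglyMeasurable f₀).measurable).aestronglyMeasurable

theorem self_mem_boundedBy [Fact (1 ≤ p)] {f₀ : Lp ℝ p μ} (hf₀ : ∀ᵐ x ∂μ, 0 < f₀ x) :
    f₀ ∈ boundedBy f₀ := by
  refine ⟨1, abs_le_smul_of_ae ?_⟩
  filter_upwards [hf₀] with x hx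
  rw [one_mul, abs_of_pos hx]

variable [hp1 : Fact (1 ≤ p)] {f₀ : Lp ℝ p μ} [IsFiniteMeasure (weightedMeasure f₀)]

theorem memLp_div (hf₀ : ∀ᵐ x ∂μ, 0 < f₀ x) (f : boundedBy f₀) :
    MemLp (fun x => (f : Lp ℝ p μ) x / f₀ x) 2 (weightedMeasure f₀) := by
  obtain ⟨c, hc⟩ := f.2
  exact MemLp.of_bound (aestronglyMeasurable_div _ _ _) c (ae_abs_div_le hf₀ hc)

/-- Division by `f₀`, as a map from the functions bounded by a multiple of `f₀` to the `L²` space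
of the weighted measure. -/
def divMap (hf₀ : ∀ᵐ x ∂μ, 0 < f₀ x) : boundedBy f₀ →ₗ[ℝ] Lp ℝ 2 (weightedMeasure f₀) where
  toFun f := (memLp_div hf₀ f).toLp _
  map_add' f g := by
    refine Lp.ext ?_
    filter_upwards [(memLp_div hf₀ (f + g)).coeFn_toLp, (memLp_div hf₀ f).coeFn_toLp,
      (memLp_div hf₀ g).coeFn_toLp, Lp.coeFn_add ((memLp_div hf₀ f).toLp _)
        ((memLp_div hf₀ g).toLp _),
      ae_weightedMeasure_of_ae f₀ (Lp.coeFn_add (f : Lp ℝ p μ) g)] with x h1 h2 h3 h4 h5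
    rw [h1, h4, Pi.add_apply, h2, h3, Submodule.coe_add, h5, Pi.add_apply, add_div]
  map_smul' a f := by
    refine Lp.ext ?_
    filter_upwards [(memLp_div hf₀ (a • f)).coeFn_toLp, (memLp_div hf₀ f).coeFn_toLp,
      Lp.coeFn_smul a ((memLp_div hf₀ f).toLp _),
      ae_weightedMeasure_of_ae f₀ (Lp.coeFn_smul a (f : Lp ℝ p μ))] with x h1 h2 h3 h4
    rw [h1, RingHom.id_apply, h3, Pi.smul_apply, h2, Submodule.coe_smul, h4, Pi.smul_apply,
      smul_eq_mul, smul_eq_mul, mul_div_assoc]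

theorem coeFn_divMap (hf₀ : ∀ᵐ x ∂μ, 0 < f₀ x) (f : boundedBy f₀) :
    divMap hf₀ f =ᵐ[weightedMeasure f₀] fun x => (f : Lp ℝ p μ) x / f₀ x :=
  (memLp_div hf₀ f).coeFn_toLp

theorem coeFn_eq_mul_divMap (hf₀ : ∀ᵐ x ∂μ, 0 < f₀ x) (f : boundedBy f₀) :
    (f : Lp ℝ p μ) =ᵐ[μ] fun x => f₀ x * divMap hf₀ f x := by
  filter_upwards [hf₀, ae_of_ae_weightedMeasure hf₀ (coeFn_divMap hf₀ f)] with x h1 h2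
  rw [h2, mul_div_cancel₀ _ h1.ne']

theorem divMap_le_divMap (hf₀ : ∀ᵐ x ∂μ, 0 < f₀ x) {f g : boundedBy f₀} :
    divMap hf₀ f ≤ divMap hf₀ g ↔ (f : Lp ℝ p μ) ≤ g := by
  rw [← Lp.coeFn_le, ← Lp.coeFn_le]
  constructor
  · intro h
    filter_upwards [hf₀, ae_of_ae_weightedMeasure hf₀ h, coeFn_eq_mul_divMap hf₀ f,
      coeFn_eq_mul_divMap hf₀ g] with x h1 h2 h3 h4
    rw [h3, h4]
    exact mul_le_mul_of_nonneg_left h2 h1.le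
  · intro h
    filter_upwards [ae_weightedMeasure_of_ae f₀ hf₀, ae_weightedMeasure_of_ae f₀ h,
      coeFn_divMap hf₀ f, coeFn_divMap hf₀ g] with x h1 h2 h3 h4
    rw [h3, h4]
    exact div_le_div_of_nonneg_right h2 h1.le

theorem divMap_nonneg (hf₀ : ∀ᵐ x ∂μ, 0 < f₀ x) {f : boundedBy f₀} :
    0 ≤ divMap hf₀ f ↔ 0 ≤ (f : Lp ℝ p μ) := by
  rw [← map_zero (divMap hf₀), divMap_le_divMap]
  rfl

theorem divMap_injective (hf₀ : ∀ᵐ x ∂μ, 0 < f₀ x) : Function.Injective (divMap hf₀) :=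
  fun _ _ h => Subtype.ext (le_antisymm ((divMap_le_divMap hf₀).1 h.le)
    ((divMap_le_divMap hf₀).1 h.ge))

theorem divMap_self (hf₀ : ∀ᵐ x ∂μ, 0 < f₀ x) :
    divMap hf₀ ⟨f₀, self_mem_boundedBy hf₀⟩ = oneL2 (weightedMeasure f₀) := by
  refine Lp.ext ?_
  filter_upwards [ae_weightedMeasure_of_ae f₀ hf₀, coeFn_oneL2 (ν := weightedMeasure f₀),
    coeFn_divMap hf₀ ⟨f₀, self_mem_boundedBy hf₀⟩] with x h1 h2 h3
  rw [h3, h2, div_self h1.ne']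

theorem abs_divMap_le (hf₀ : ∀ᵐ x ∂μ, 0 < f₀ x) {f : boundedBy f₀} {c : ℝ} :
    |divMap hf₀ f| ≤ c • oneL2 (weightedMeasure f₀) ↔ |(f : Lp ℝ p μ)| ≤ c • f₀ := by
  have h1 : c • f₀ ∈ boundedBy f₀ := Submodule.smul_mem _ _ (self_mem_boundedBy hf₀)
  have h2 : divMap hf₀ ⟨c • f₀, h1⟩ = c • oneL2 (weightedMeasure f₀) := by
    rw [← divMap_self hf₀, ← map_smul]
    rfl
  rw [abs_le', abs_le', ← h2, ← map_neg, divMap_le_divMap, divMap_le_divMap]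
  rfl

theorem exists_divMap_eq (hf₀ : ∀ᵐ x ∂μ, 0 < f₀ x) {h : Lp ℝ 2 (weightedMeasure f₀)} {c : ℝ}
    (hc : |h| ≤ c • oneL2 (weightedMeasure f₀)) : ∃ f : boundedBy f₀, divMap hf₀ f = h := by
  have h1 : ∀ᵐ x ∂μ, |h x| ≤ c := by
    refine ae_of_ae_weightedMeasure hf₀ ?_
    filter_upwards [ae_abs_le_of_abs_le_smul hc, coeFn_oneL2 (ν := weightedMeasure f₀)]
      with x h2 h3
    rwa [h3, mul_one] at h2
  have hmem : MemLp (fun x => f₀ x * h x) p μ := by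
    refine MemLp.of_le_mul (c := c) (Lp.memLp f₀) ((Lp.aestronglyMeasurable f₀).mul
      (Lp.stronglyMeasurable h).aestronglyMeasurable) ?_
    filter_upwards [h1] with x hx
    rw [norm_mul, mul_comm]
    exact mul_le_mul_of_nonneg_right hx (norm_nonneg _)
  have hb : |hmem.toLp _| ≤ c • f₀ := by
    refine abs_le_smul_of_ae ?_
    filter_upwards [h1, hmem.coeFn_toLp, hf₀] with x h2 h3 h4
    rw [h3, abs_mul, mul_comm, abs_of_pos h4]
    exact mul_le_mul_of_nonneg_right h2 h4.le
  refine ⟨⟨hmem.toLp _, c, hb⟩, Lp.ext ?_⟩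
  filter_upwards [coeFn_divMap hf₀ ⟨hmem.toLp _, c, hb⟩, ae_weightedMeasure_of_ae f₀ hf₀,
    ae_weightedMeasure_of_ae f₀ hmem.coeFn_toLp] with x h2 h3 h4
  rw [h2, h4, mul_div_cancel_left₀ _ h3.ne']

end Weighted

/-! ### Positive contractions with a strictly positive fixed function -/

section Operator

variable {Ω : Type*} [MeasurableSpace Ω] {μ : Measure Ω} {p : ℝ≥0∞} [hp1 : Fact (1 ≤ p)]
  {f₀ : Lp ℝ p μ}

theorem norm_rpow_eq_integral (hp : p ≠ ∞) (hf₀ : ∀ᵐ x ∂μ, 0 < f₀ x) (f : Lp ℝ p μ) :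
    ‖f‖ ^ p.toReal = ∫ x, |f x / f₀ x| ^ p.toReal ∂(weightedMeasure f₀) := by
  have hp0 : p ≠ 0 := (zero_lt_one.trans_le hp1.out).ne'
  have h1 := eLpNorm_div_weightedMeasure hp hf₀ f
  have h2 : MemLp (fun x => f x / f₀ x) p (weightedMeasure f₀) :=
    ⟨aestronglyMeasurable_div _ _ _, h1 ▸ Lp.eLpNorm_lt_top f⟩
  rw [h2.eLpNorm_eq_integral_rpow_norm hp0 hp] at h1
  simp only [Real.norm_eq_abs] at h1
  have h3 : 0 ≤ ∫ x, |f x / f₀ x| ^ p.toReal ∂(weightedMeasure f₀) :=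
    integral_nonneg fun x => by positivity
  rw [Lp.norm_def, ← h1, ENNReal.toReal_ofReal (by positivity),
    Real.rpow_inv_rpow h3 (ENNReal.toReal_pos hp0 hp).ne']

theorem norm_add_smul_rpow_eq_integral (hp : p ≠ ∞) (hf₀ : ∀ᵐ x ∂μ, 0 < f₀ x) {f : Lp ℝ p μ}
    {c : ℝ} (hc : |f| ≤ c • f₀) {ε : ℝ} (hε : |ε| * c ≤ 1) :
    ‖f₀ + ε • f‖ ^ p.toReal
      = ∫ x, (1 + ε * (f x / f₀ x)) ^ p.toReal ∂(weightedMeasure f₀) := by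
  rw [norm_rpow_eq_integral hp hf₀]
  refine integral_congr_ae ?_
  filter_upwards [ae_weightedMeasure_of_ae f₀ hf₀, ae_abs_div_le hf₀ hc,
    ae_weightedMeasure_of_ae f₀ (Lp.coeFn_add f₀ (ε • f)),
    ae_weightedMeasure_of_ae f₀ (Lp.coeFn_smul ε f)] with x h1 h2 h3 h4
  rw [h3, Pi.add_apply, h4, Pi.smul_apply, smul_eq_mul, add_div, div_self h1.ne', mul_div_assoc,
    abs_of_nonneg]
  have h5 : |ε * (f x / f₀ x)| ≤ 1 := by
    rw [abs_mul]
    exact (mul_le_mul_of_nonneg_left h2 (abs_nonneg _)).trans hε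
  linarith [(abs_le.1 h5).1]

variable [IsFiniteMeasure (weightedMeasure f₀)]

omit hp1 in
theorem integrable_div (hf₀ : ∀ᵐ x ∂μ, 0 < f₀ x) {f : Lp ℝ p μ} {c : ℝ} (hc : |f| ≤ c • f₀) :
    Integrable (fun x => f x / f₀ x) (weightedMeasure f₀) :=
  Integrable.of_bound (aestronglyMeasurable_div _ _ _) c (ae_abs_div_le hf₀ hc)

theorem one_le_toReal_of_fact (hp : p ≠ ∞) : 1 ≤ p.toReal := by
  rw [← ENNReal.toReal_one]
  exact ENNReal.toReal_mono hp hp1.out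

theorem le_norm_add_smul_rpow (hp : p ≠ ∞) (hf₀ : ∀ᵐ x ∂μ, 0 < f₀ x) {f : Lp ℝ p μ}
    {c : ℝ} (hc : |f| ≤ c • f₀) {ε : ℝ} (hε : |ε| * c ≤ 1) :
    (weightedMeasure f₀).real Set.univ +
      p.toReal * (ε * ∫ x, f x / f₀ x ∂(weightedMeasure f₀)) ≤ ‖f₀ + ε • f‖ ^ p.toReal := by
  have hr := one_le_toReal_of_fact hp
  rw [norm_add_smul_rpow_eq_integral hp hf₀ hc hε]
  have hintg := ((integrable_div hf₀ hc).const_mul ε).const_mul p.toReal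
  have h1 : (weightedMeasure f₀).real Set.univ +
      p.toReal * (ε * ∫ x, f x / f₀ x ∂(weightedMeasure f₀))
      = ∫ x, (1 + p.toReal * (ε * (f x / f₀ x))) ∂(weightedMeasure f₀) := by
    rw [integral_add (integrable_const _) hintg, integral_const_mul, integral_const_mul]
    simp
  have hbd : ∀ᵐ x ∂(weightedMeasure f₀), |ε * (f x / f₀ x)| ≤ 1 := by
    filter_upwards [ae_abs_div_le hf₀ hc] with x h2
    rw [abs_mul]
    exact (mul_le_mul_of_nonneg_left h2 (abs_nonneg _)).trans hε
  rw [h1]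
  refine integral_mono_ae ((integrable_const _).add hintg) ?_ ?_
  · refine Integrable.of_bound (C := 2 ^ p.toReal) ?_ ?_
    · exact ((((Lp.stronglyMeasurable f).measurable.div
        (Lp.stronglyMeasurable f₀).measurable).const_mul ε).const_add 1
        |>.pow_const _).aestronglyMeasurable
    · filter_upwards [hbd] with x h2
      have h3 := abs_le.1 h2
      rw [Real.norm_eq_abs, abs_of_nonneg (Real.rpow_nonneg (by linarith [h3.1]) _)]
      exact Real.rpow_le_rpow (by linarith [h3.1]) (by linarith [h3.2]) (by linarith)
  · filter_upwards [hbd] with x h2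
    exact one_add_mul_self_le_rpow_one_add (abs_le.1 h2).1 hr

theorem hasDerivAt_norm_add_smul_rpow (hp : p ≠ ∞) (hf₀ : ∀ᵐ x ∂μ, 0 < f₀ x) {f : Lp ℝ p μ}
    {c : ℝ} (hc0 : 0 ≤ c) (hc : |f| ≤ c • f₀) :
    HasDerivAt (fun ε : ℝ => ‖f₀ + ε • f‖ ^ p.toReal)
      (p.toReal * ∫ x, f x / f₀ x ∂(weightedMeasure f₀)) 0 := by
  have hr := one_le_toReal_of_fact hp
  set δ : ℝ := 1 / (2 * (c + 1)) with hδ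
  have hδ0 : 0 < δ := by positivity
  have hδc : ∀ ε ∈ Metric.ball (0 : ℝ) δ, |ε| * c ≤ 1 / 2 := fun ε hε => by
    rw [mem_ball_zero_iff, Real.norm_eq_abs] at hε
    calc |ε| * c ≤ δ * (c + 1) := by gcongr; linarith
      _ = 1 / 2 := by rw [hδ]; field_simp
  have hbd : ∀ᵐ x ∂(weightedMeasure f₀), ∀ ε ∈ Metric.ball (0 : ℝ) δ,
      |ε * (f x / f₀ x)| ≤ 1 / 2 := by
    filter_upwards [ae_abs_div_le hf₀ hc] with x h2 ε hε
    rw [abs_mul]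
    exact (mul_le_mul_of_nonneg_left h2 (abs_nonneg _)).trans (hδc ε hε)
  have hmeas : Measurable fun x => f x / f₀ x :=
    (Lp.stronglyMeasurable f).measurable.div (Lp.stronglyMeasurable f₀).measurable
  have key := (hasDerivAt_integral_of_dominated_loc_of_deriv_le (μ := weightedMeasure f₀)
    (F := fun (ε : ℝ) x => (1 + ε * (f x / f₀ x)) ^ p.toReal)
    (F' := fun (ε : ℝ) x => (f x / f₀ x) * p.toReal * (1 + ε * (f x / f₀ x)) ^ (p.toReal - 1))
    (x₀ := 0) (s := Metric.ball 0 δ) (bound := fun _ => c * p.toReal * 2 ^ (p.toReal - 1))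
    (Metric.ball_mem_nhds _ hδ0) (Eventually.of_forall fun ε =>
      (((hmeas.const_mul ε).const_add 1).pow_const _).aestronglyMeasurable)
    (by simp)
    (((hmeas.mul_const _).mul
      (((hmeas.const_mul 0).const_add 1).pow_const _)).aestronglyMeasurable) ?_
    (integrable_const _) ?_).2
  · have h1 : ∫ x, (f x / f₀ x) * p.toReal * (1 + 0 * (f x / f₀ x)) ^ (p.toReal - 1)
        ∂(weightedMeasure f₀) = p.toReal * ∫ x, f x / f₀ x ∂(weightedMeasure f₀) := by
      rw [← integral_const_mul]
      refine integral_congr_ae (ae_of_all _ fun x => ?_)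
      simp [mul_comm]
    rw [h1] at key
    refine key.congr_of_eventuallyEq ?_
    filter_upwards [Metric.ball_mem_nhds (0 : ℝ) hδ0] with ε hε
    exact norm_add_smul_rpow_eq_integral hp hf₀ hc ((hδc ε hε).trans (by norm_num))
  · filter_upwards [hbd, ae_abs_div_le hf₀ hc] with x h1 h2 ε hε
    have h3 := abs_le.1 (h1 ε hε)
    have h4 : 0 ≤ 1 + ε * (f x / f₀ x) := by linarith [h3.1]
    rw [Real.norm_eq_abs, abs_mul, abs_mul, abs_of_nonneg (Real.rpow_nonneg h4 _),
      abs_of_nonneg (zero_le_one.trans hr)]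
    gcongr
    linarith [h3.2]
  · filter_upwards [hbd] with x h1 ε hε
    have h3 := abs_le.1 (h1 ε hε)
    have h4 : 1 + ε * (f x / f₀ x) ≠ 0 := by linarith [h3.1]
    have h5 : HasDerivAt (fun ε : ℝ => 1 + ε * (f x / f₀ x)) (f x / f₀ x) ε := by
      simpa using ((hasDerivAt_id ε).mul_const (f x / f₀ x)).const_add 1
    exact h5.rpow_const (Or.inl h4)

variable {T : Lp ℝ p μ →L[ℝ] Lp ℝ p μ}

omit [IsFiniteMeasure (weightedMeasure f₀)] in
theorem IsPositiveOp.mono (hT : IsPositiveOp T) {f g : Lp ℝ p μ} (h : f ≤ g) : T f ≤ T g := by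
  have := hT _ (sub_nonneg.2 h)
  rwa [map_sub, sub_nonneg] at this

omit [IsFiniteMeasure (weightedMeasure f₀)] in
theorem IsPositiveOp.abs_apply_le_smul (hT : IsPositiveOp T) (hfix : T f₀ = f₀) {f : Lp ℝ p μ}
    {c : ℝ} (hc : |f| ≤ c • f₀) : |T f| ≤ c • f₀ := by
  have h1 : T (c • f₀) = c • f₀ := by rw [map_smul, hfix]
  rw [← h1]
  refine abs_le'.2 ⟨hT.mono ((le_abs_self f).trans hc), ?_⟩
  rw [← map_neg]
  exact hT.mono ((neg_le_abs f).trans hc)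

/-- A positive contraction fixing `f₀` preserves the integral with respect to the weighted
measure. -/
theorem IsPositiveOp.integral_div_apply (hp : p ≠ ∞) (hf₀ : ∀ᵐ x ∂μ, 0 < f₀ x)
    (hT : IsPositiveOp T) (hcontr : ∀ f, ‖T f‖ ≤ ‖f‖) (hfix : T f₀ = f₀) {f : Lp ℝ p μ}
    {c : ℝ} (hc0 : 0 ≤ c) (hc : |f| ≤ c • f₀) :
    ∫ x, T f x / f₀ x ∂(weightedMeasure f₀) = ∫ x, f x / f₀ x ∂(weightedMeasure f₀) := by
  have hr := one_le_toReal_of_fact hp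
  set a := ∫ x, T f x / f₀ x ∂(weightedMeasure f₀) with ha
  have h1 : HasDerivAt (fun ε : ℝ => ‖f₀ + ε • f‖ ^ p.toReal - p.toReal * (ε * a))
      (p.toReal * ∫ x, f x / f₀ x ∂(weightedMeasure f₀) - p.toReal * (1 * a)) 0 :=
    (hasDerivAt_norm_add_smul_rpow hp hf₀ hc0 hc).sub
      (((hasDerivAt_id (0 : ℝ)).mul_const a).const_mul p.toReal)
  have h2 : IsLocalMin (fun ε : ℝ => ‖f₀ + ε • f‖ ^ p.toReal - p.toReal * (ε * a)) 0 := by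
    have hδ0 : 0 < 1 / (c + 1) := by positivity
    filter_upwards [Metric.ball_mem_nhds (0 : ℝ) hδ0] with ε hε
    rw [mem_ball_zero_iff, Real.norm_eq_abs] at hε
    have hεc : |ε| * c ≤ 1 := by
      calc |ε| * c ≤ 1 / (c + 1) * (c + 1) := by gcongr; linarith
        _ = 1 := by field_simp
    have h3 := le_norm_add_smul_rpow hp hf₀ (hT.abs_apply_le_smul hfix hc) hεc
    have h4 : ‖f₀ + ε • T f‖ ^ p.toReal ≤ ‖f₀ + ε • f‖ ^ p.toReal := by
      have h5 : f₀ + ε • T f = T (f₀ + ε • f) := by rw [map_add, map_smul, hfix]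
      rw [h5]
      exact Real.rpow_le_rpow (norm_nonneg _) (hcontr _) (by linarith)
    have h6 : ‖f₀ + (0 : ℝ) • f‖ ^ p.toReal = (weightedMeasure f₀).real Set.univ := by
      rw [norm_add_smul_rpow_eq_integral hp hf₀ hc (by simp)]
      simp
    rw [h6]
    linarith
  have h3 := h2.hasDerivAt_eq_zero h1
  have h4 : p.toReal * (∫ x, f x / f₀ x ∂(weightedMeasure f₀) - a) = 0 := by linarith
  rcases mul_eq_zero.1 h4 with h5 | h5 <;> linarith

/-- The restriction of a positive operator fixing `f₀` to the functions bounded by a multiple of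
`f₀`. -/
def IsPositiveOp.restrict (hT : IsPositiveOp T) (hfix : T f₀ = f₀) :
    boundedBy f₀ →ₗ[ℝ] boundedBy f₀ :=
  (T : Lp ℝ p μ →ₗ[ℝ] Lp ℝ p μ).restrict fun _ hf =>
    ⟨_, hT.abs_apply_le_smul hfix hf.choose_spec⟩

omit [IsFiniteMeasure (weightedMeasure f₀)] in
theorem IsPositiveOp.coe_restrict (hT : IsPositiveOp T) (hfix : T f₀ = f₀) (f : boundedBy f₀) :
    (hT.restrict hfix f : Lp ℝ p μ) = T f := rfl

theorem IsPositiveOp.inner_one_divMap_restrict (hp : p ≠ ∞) (hf₀ : ∀ᵐ x ∂μ, 0 < f₀ x)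
    (hT : IsPositiveOp T) (hcontr : ∀ f, ‖T f‖ ≤ ‖f‖) (hfix : T f₀ = f₀) (f : boundedBy f₀) :
    inner ℝ (oneL2 (weightedMeasure f₀)) (divMap hf₀ (hT.restrict hfix f))
      = inner ℝ (oneL2 (weightedMeasure f₀)) (divMap hf₀ f) := by
  obtain ⟨c, hc⟩ := f.2
  have hc' : |(f : Lp ℝ p μ)| ≤ |c| • f₀ := abs_le_smul_of_ae (by
    filter_upwards [hf₀, ae_abs_le_of_abs_le_smul hc] with x h1 h2
    exact h2.trans (mul_le_mul_of_nonneg_right (le_abs_self c) h1.le))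
  rw [inner_oneL2_left, inner_oneL2_left, integral_congr_ae (coeFn_divMap hf₀ _),
    integral_congr_ae (coeFn_divMap hf₀ _)]
  exact hT.integral_div_apply hp hf₀ hcontr hfix (abs_nonneg c) hc'

/-- A positive contraction fixing `f₀` is contractive in the weighted `L²` norm. -/
theorem IsPositiveOp.norm_divMap_restrict_le (hp : p ≠ ∞) (hf₀ : ∀ᵐ x ∂μ, 0 < f₀ x)
    (hT : IsPositiveOp T) (hcontr : ∀ f, ‖T f‖ ≤ ‖f‖) (hfix : T f₀ = f₀) (f : boundedBy f₀) :
    ‖divMap hf₀ (hT.restrict hfix f)‖ ≤ ‖divMap hf₀ f‖ := by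
  obtain ⟨c, hc⟩ := f.2
  have hbd := ae_abs_div_le hf₀ hc
  have hsq : MemLp (fun x => divMap hf₀ f x ^ 2) 2 (weightedMeasure f₀) := by
    refine MemLp.of_bound ((Lp.aestronglyMeasurable _).pow 2) (c ^ 2) ?_
    filter_upwards [hbd, coeFn_divMap hf₀ f] with x h1 h2
    rw [h2, norm_pow, Real.norm_eq_abs]
    gcongr
  obtain ⟨q, hq⟩ := exists_divMap_eq hf₀ (h := hsq.toLp _) (c := c ^ 2) (by
    refine abs_le_smul_of_ae ?_
    filter_upwards [hbd, coeFn_divMap hf₀ f, hsq.coeFn_toLp,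
      coeFn_oneL2 (ν := weightedMeasure f₀)] with x h1 h2 h3 h4
    rw [h3, h2, h4, abs_pow, mul_one]
    gcongr)
  have hqx : divMap hf₀ q =ᵐ[weightedMeasure f₀] fun x => divMap hf₀ f x ^ 2 := by
    rw [hq]
    exact hsq.coeFn_toLp
  have hlow : ∀ a : ℝ, (2 * a) • f - (a ^ 2) • ⟨f₀, self_mem_boundedBy hf₀⟩ ≤ q := fun a => by
    change (((2 * a) • f - (a ^ 2) • (⟨f₀, self_mem_boundedBy hf₀⟩ : boundedBy f₀) :
      boundedBy f₀) : Lp ℝ p μ) ≤ q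
    rw [← divMap_le_divMap hf₀, map_sub, map_smul, map_smul, divMap_self, ← Lp.coeFn_le]
    filter_upwards [hqx, coeFn_oneL2 (ν := weightedMeasure f₀),
      Lp.coeFn_sub ((2 * a) • divMap hf₀ f) ((a ^ 2) • oneL2 (weightedMeasure f₀)),
      Lp.coeFn_smul (2 * a) (divMap hf₀ f), Lp.coeFn_smul (a ^ 2) (oneL2 (weightedMeasure f₀))]
      with x h1 h2 h3 h4 h5
    rw [h1, h3, Pi.sub_apply, h4, h5, Pi.smul_apply, Pi.smul_apply, h2, smul_eq_mul, smul_eq_mul]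
    nlinarith [sq_nonneg (divMap hf₀ f x - a)]
  have hTf₀ : hT.restrict hfix ⟨f₀, self_mem_boundedBy hf₀⟩ = ⟨f₀, self_mem_boundedBy hf₀⟩ :=
    Subtype.ext hfix
  have hTlow : ∀ a : ℝ, ∀ᵐ x ∂(weightedMeasure f₀),
      2 * a * divMap hf₀ (hT.restrict hfix f) x - a ^ 2 ≤ divMap hf₀ (hT.restrict hfix q) x :=
    fun a => by
    have h1 : hT.restrict hfix ((2 * a) • f - (a ^ 2) • ⟨f₀, self_mem_boundedBy hf₀⟩)
        ≤ hT.restrict hfix q := hT.mono (hlow a)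
    have h2 := (Lp.coeFn_le _ _).2 ((divMap_le_divMap hf₀).2 h1)
    rw [map_sub, map_smul, map_smul, hTf₀, map_sub, map_smul, map_smul, divMap_self] at h2
    filter_upwards [h2, coeFn_oneL2 (ν := weightedMeasure f₀),
      Lp.coeFn_sub ((2 * a) • divMap hf₀ (hT.restrict hfix f))
        ((a ^ 2) • oneL2 (weightedMeasure f₀)),
      Lp.coeFn_smul (2 * a) (divMap hf₀ (hT.restrict hfix f)),
      Lp.coeFn_smul (a ^ 2) (oneL2 (weightedMeasure f₀))] with x h1 h2 h3 h4 h5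
    rw [h3, Pi.sub_apply, h4, h5, Pi.smul_apply, Pi.smul_apply, h2, smul_eq_mul, smul_eq_mul,
      mul_one] at h1
    exact h1
  have hle : ∀ᵐ x ∂(weightedMeasure f₀), divMap hf₀ (hT.restrict hfix f) x ^ 2
      ≤ divMap hf₀ (hT.restrict hfix q) x := by
    have h1 : ∀ᵐ x ∂(weightedMeasure f₀), ∀ a : ℚ,
        2 * (a : ℝ) * divMap hf₀ (hT.restrict hfix f) x - (a : ℝ) ^ 2
          ≤ divMap hf₀ (hT.restrict hfix q) x := ae_all_iff.2 fun a => hTlow a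
    filter_upwards [h1] with x hx
    have h2 : ∀ a : ℝ, 2 * a * divMap hf₀ (hT.restrict hfix f) x - a ^ 2
        ≤ divMap hf₀ (hT.restrict hfix q) x := fun a =>
      Rat.denseRange_cast.induction_on (p := fun a : ℝ =>
        2 * a * divMap hf₀ (hT.restrict hfix f) x - a ^ 2 ≤ divMap hf₀ (hT.restrict hfix q) x) a
        (isClosed_le (by fun_prop) continuous_const) hx
    have h3 := h2 (divMap hf₀ (hT.restrict hfix f) x)
    nlinarith
  have hnorm : ∀ h : Lp ℝ 2 (weightedMeasure f₀),
      ‖h‖ ^ 2 = ∫ x, h x ^ 2 ∂(weightedMeasure f₀) := fun h => by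
    rw [← real_inner_self_eq_norm_sq, L2_inner_eq_integral]
    simp only [sq]
  rw [← sq_le_sq₀ (norm_nonneg _) (norm_nonneg _), hnorm, hnorm, ← integral_congr_ae hqx,
    ← inner_oneL2_left, ← hT.inner_one_divMap_restrict hp hf₀ hcontr hfix q, inner_oneL2_left]
  exact integral_mono_of_nonneg (ae_of_all _ fun x => sq_nonneg _) (L2_integrable _) hle

end Operator

/-! ### Truncation and comparison of norms -/

section Truncation

variable {Ω : Type*} [MeasurableSpace Ω]

/-- Every function in `L^p` is the limit of its truncations by multiples of a strictly positive
function. -/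
theorem exists_tendsto_abs_le_smul {m : Measure Ω} {p : ℝ≥0∞} [Fact (1 ≤ p)] (hp : p ≠ ∞)
    {φ : Lp ℝ p m} (hφ : ∀ᵐ x ∂m, 0 < φ x) (f : Lp ℝ p m) :
    ∃ F : ℕ → Lp ℝ p m, (∀ n, |F n| ≤ (n : ℝ) • φ) ∧ (0 ≤ f → ∀ n, 0 ≤ F n) ∧
      Tendsto F atTop (nhds f) := by
  have hφ0 : 0 ≤ φ := by
    rw [← Lp.coeFn_nonneg]
    filter_upwards [hφ] with x hx using hx.le
  have hx : ∀ᵐ x ∂m, ∀ n : ℕ,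
      ((f ⊓ (n : ℝ) • φ) ⊔ -((n : ℝ) • φ) : Lp ℝ p m) x
        = max (min (f x) (n * φ x)) (-(n * φ x)) := by
    rw [ae_all_iff]
    intro n
    filter_upwards [Lp.coeFn_sup (f ⊓ (n : ℝ) • φ) (-((n : ℝ) • φ)), Lp.coeFn_inf f ((n : ℝ) • φ),
      Lp.coeFn_neg ((n : ℝ) • φ), Lp.coeFn_smul (n : ℝ) φ] with x h1 h2 h3 h4
    rw [h1, Pi.sup_apply, h2, Pi.inf_apply, h3, Pi.neg_apply, h4]
    rfl
  refine ⟨fun n => (f ⊓ (n : ℝ) • φ) ⊔ -((n : ℝ) • φ), fun n => ?_, fun hf n => ?_, ?_⟩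
  · refine abs_le_smul_of_ae ?_
    filter_upwards [hx, hφ] with x h1 h2
    have h3 : 0 ≤ n * φ x := by positivity
    rw [h1, abs_le]
    exact ⟨le_max_right _ _, max_le (min_le_right _ _) (by linarith)⟩
  · exact le_sup_of_le_left (le_inf hf (Lp_smul_nonneg n.cast_nonneg hφ0))
  · refine Lp_tendsto_of_dominated hp (h := f) (fun n => ?_) ?_
    · rw [← Lp.coeFn_le]
      filter_upwards [hx, hφ, Lp.coeFn_abs f, Lp.coeFn_abs ((f ⊓ (n : ℝ) • φ) ⊔ -((n : ℝ) • φ) - f),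
        Lp.coeFn_sub ((f ⊓ (n : ℝ) • φ) ⊔ -((n : ℝ) • φ)) f] with x h1 h2 h3 h4 h5
      have h6 : 0 ≤ n * φ x := by positivity
      rw [h3, h4, h5, Pi.sub_apply, h1]
      rcases max_cases (min (f x) (n * φ x)) (-(n * φ x)) with h7 | h7 <;>
      rcases min_cases (f x) (n * φ x) with h8 | h8 <;>
      rcases abs_cases (f x) with h9 | h9 <;>
      rw [abs_le] <;> constructor <;> linarith
    · filter_upwards [hx, hφ] with x h1 h2
      refine tendsto_const_nhds.congr' ?_
      filter_upwards [eventually_ge_atTop ⌈|f x| / φ x⌉₊] with n hn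
      have h3 : |f x| ≤ n * φ x := (div_le_iff₀ h2).1 (Nat.ceil_le.1 hn)
      rw [h1, min_eq_left (abs_le.1 h3).2, max_eq_left (abs_le.1 h3).1]

/-- On a finite measure space, convergence to zero of uniformly bounded functions in some `L^b`
implies convergence to zero in every `L^a`. -/
theorem tendsto_eLpNorm_zero_of_bounded {ν : Measure Ω} [IsFiniteMeasure ν] {ι : Type*}
    {l : Filter ι} {g : ι → Ω → ℝ} {c : ℝ} (hg : ∀ i, AEStronglyMeasurable (g i) ν)
    (hc : ∀ i, ∀ᵐ x ∂ν, |g i x| ≤ c) {a b : ℝ≥0∞} (ha : 1 ≤ a) (ha' : a ≠ ∞) (hb : 1 ≤ b)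
    (h : Tendsto (fun i => eLpNorm (g i) b ν) l (nhds 0)) :
    Tendsto (fun i => eLpNorm (g i) a ν) l (nhds 0) := by
  have ha0 : a ≠ 0 := (zero_lt_one.trans_le ha).ne'
  have har : 1 ≤ a.toReal := by
    rw [← ENNReal.toReal_one]
    exact ENNReal.toReal_mono ha' ha
  have hbr : b.toReal⁻¹ ≤ 1 := by
    rcases eq_or_ne b ∞ with rfl | hb'
    · simp
    · refine inv_le_one_of_one_le₀ ?_
      rw [← ENNReal.toReal_one]
      exact ENNReal.toReal_mono hb' hb
  have h1 : Tendsto (fun i => eLpNorm (g i) 1 ν) l (nhds 0) := by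
    have hpow : ν Set.univ ^ (1 / (1 : ℝ≥0∞).toReal - 1 / b.toReal) ≠ ∞ :=
      ENNReal.rpow_ne_top_of_nonneg (by simpa using hbr) (measure_ne_top _ _)
    have h2 := ENNReal.Tendsto.mul_const h (Or.inr hpow)
    rw [zero_mul] at h2
    exact tendsto_of_tendsto_of_tendsto_of_le_of_le tendsto_const_nhds h2
      (fun _ => bot_le) fun i => eLpNorm_le_eLpNorm_mul_rpow_measure_univ hb (hg i)
  have hle : ∀ i, eLpNorm (g i) a ν
      ≤ (ENNReal.ofReal c ^ (a.toReal - 1) * eLpNorm (g i) 1 ν) ^ (1 / a.toReal) := fun i => by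
    rw [eLpNorm_eq_lintegral_rpow_enorm_toReal ha0 ha', eLpNorm_one_eq_lintegral_enorm,
      ← lintegral_const_mul' _ _
          (ENNReal.rpow_ne_top_of_nonneg (by linarith) ENNReal.ofReal_ne_top)]
    gcongr ?_ ^ (1 / a.toReal)
    refine lintegral_mono_ae ?_
    filter_upwards [hc i] with x hx
    have h3 : ‖g i x‖ₑ ^ a.toReal = ‖g i x‖ₑ ^ (a.toReal - 1) * ‖g i x‖ₑ := by
      nth_rw 3 [← ENNReal.rpow_one ‖g i x‖ₑ]
      rw [← ENNReal.rpow_add_of_nonneg _ _ (by linarith) zero_le_one, sub_add_cancel]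
    rw [h3]
    gcongr
    rw [Real.enorm_eq_ofReal_abs]
    exact ENNReal.ofReal_le_ofReal hx
  have h4 : Tendsto (fun i => (ENNReal.ofReal c ^ (a.toReal - 1) * eLpNorm (g i) 1 ν)
      ^ (1 / a.toReal)) l (nhds 0) := by
    have h5 := ENNReal.Tendsto.const_mul (a := ENNReal.ofReal c ^ (a.toReal - 1)) h1
      (Or.inr (ENNReal.rpow_ne_top_of_nonneg (by linarith) ENNReal.ofReal_ne_top))
    rw [mul_zero] at h5
    have h6 := ((ENNReal.continuous_rpow_const (y := 1 / a.toReal)).tendsto 0).comp h5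
    rwa [ENNReal.zero_rpow_of_pos (by positivity)] at h6
  exact tendsto_of_tendsto_of_tendsto_of_le_of_le tendsto_const_nhds h4 (fun _ => bot_le) hle

variable {μ : Measure Ω} {p : ℝ≥0∞} [hp1 : Fact (1 ≤ p)] {f₀ : Lp ℝ p μ}
  [IsFiniteMeasure (weightedMeasure f₀)]

theorem tendsto_divMap_zero_iff (hp : p ≠ ∞) (hf₀ : ∀ᵐ x ∂μ, 0 < f₀ x) {ι : Type*} {l : Filter ι}
    {f : ι → boundedBy f₀} {c : ℝ} (hc : ∀ i, |(f i : Lp ℝ p μ)| ≤ c • f₀) :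
    Tendsto (fun i => divMap hf₀ (f i)) l (nhds 0)
      ↔ Tendsto (fun i => (f i : Lp ℝ p μ)) l (nhds 0) := by
  rw [tendsto_zero_iff_enorm_tendsto_zero,
    tendsto_zero_iff_enorm_tendsto_zero (f := fun i => (f i : Lp ℝ p μ))]
  simp_rw [Lp.enorm_def, fun i => eLpNorm_congr_ae (p := 2) (coeFn_divMap hf₀ (f i)),
    ← fun i => eLpNorm_div_weightedMeasure hp hf₀ (f i : Lp ℝ p μ)]
  have h1 := fun i => aestronglyMeasurable_div f₀ (f i : Lp ℝ p μ) (weightedMeasure f₀)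
  have h2 := fun i => ae_abs_div_le hf₀ (hc i)
  exact ⟨tendsto_eLpNorm_zero_of_bounded h1 h2 hp1.out hp one_le_two,
    tendsto_eLpNorm_zero_of_bounded h1 h2 one_le_two ENNReal.ofNat_ne_top hp1.out⟩

theorem tendsto_divMap_iff (hp : p ≠ ∞) (hf₀ : ∀ᵐ x ∂μ, 0 < f₀ x) {ι : Type*} {l : Filter ι}
    {f : ι → boundedBy f₀} {g : boundedBy f₀} {c : ℝ} (hc : ∀ i, |(f i : Lp ℝ p μ)| ≤ c • f₀) :
    Tendsto (fun i => divMap hf₀ (f i)) l (nhds (divMap hf₀ g))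
      ↔ Tendsto (fun i => (f i : Lp ℝ p μ)) l (nhds g) := by
  obtain ⟨d, hd⟩ := g.2
  have h1 : ∀ i, |((f i - g : boundedBy f₀) : Lp ℝ p μ)| ≤ (c + d) • f₀ := fun i => by
    rw [Submodule.coe_sub, sub_eq_add_neg, add_smul]
    exact (abs_add_le _ _).trans (add_le_add (hc i) ((abs_neg (g : Lp ℝ p μ)).le.trans hd))
  rw [← tendsto_sub_nhds_zero_iff, ← tendsto_sub_nhds_zero_iff (x := (g : Lp ℝ p μ))]
  have h2 := tendsto_divMap_zero_iff (l := l) hp hf₀ h1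
  simp_rw [map_sub] at h2
  exact h2

theorem exists_tendsto_divMap (hf₀ : ∀ᵐ x ∂μ, 0 < f₀ x) (h : Lp ℝ 2 (weightedMeasure f₀)) :
    ∃ F : ℕ → boundedBy f₀, (0 ≤ h → ∀ n, 0 ≤ (F n : Lp ℝ p μ)) ∧
      Tendsto (fun n => divMap hf₀ (F n)) atTop (nhds h) := by
  obtain ⟨G, hG1, hG2, hG3⟩ := exists_tendsto_abs_le_smul ENNReal.ofNat_ne_top
    (φ := oneL2 (weightedMeasure f₀)) (by
      filter_upwards [coeFn_oneL2 (ν := weightedMeasure f₀)] with x hx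
      rw [hx]
      exact zero_lt_one) h
  choose F hF using fun n => exists_divMap_eq hf₀ (hG1 n)
  refine ⟨F, fun hh n => ?_, ?_⟩
  · rw [← divMap_nonneg hf₀, hF]
    exact hG2 hh n
  · simpa only [hF] using hG3

theorem denseRange_divMap (hf₀ : ∀ᵐ x ∂μ, 0 < f₀ x) : DenseRange (divMap hf₀) := fun h => by
  obtain ⟨F, -, hF⟩ := exists_tendsto_divMap hf₀ h
  exact mem_closure_of_tendsto hF (Eventually.of_forall fun n => ⟨F n, rfl⟩)

omit [IsFiniteMeasure (weightedMeasure f₀)] in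
theorem dense_boundedBy (hp : p ≠ ∞) (hf₀ : ∀ᵐ x ∂μ, 0 < f₀ x) :
    Dense (boundedBy f₀ : Set (Lp ℝ p μ)) := fun f => by
  obtain ⟨F, hF, -, hlim⟩ := exists_tendsto_abs_le_smul hp hf₀ f
  exact mem_closure_of_tendsto hlim (Eventually.of_forall fun n => ⟨n, hF n⟩)

end Truncation

/-! ### Transfer of the semigroup to the weighted `L²` space -/

section Transfer

variable {Ω : Type*} [MeasurableSpace Ω] {μ : Measure Ω} {p : ℝ≥0∞} [hp1 : Fact (1 ≤ p)]
  {f₀ : Lp ℝ p μ} [IsFiniteMeasure (weightedMeasure f₀)]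

/-- A positive contraction fixing `f₀` induces an operator on the weighted `L²` space. -/
theorem IsPositiveOp.exists_apply_divMap_eq (hp : p ≠ ∞) (hf₀ : ∀ᵐ x ∂μ, 0 < f₀ x)
    {T : Lp ℝ p μ →L[ℝ] Lp ℝ p μ} (hT : IsPositiveOp T) (hcontr : ∀ f, ‖T f‖ ≤ ‖f‖)
    (hfix : T f₀ = f₀) :
    ∃ P : Lp ℝ 2 (weightedMeasure f₀) →L[ℝ] Lp ℝ 2 (weightedMeasure f₀),
      ∀ f : boundedBy f₀, P (divMap hf₀ f) = divMap hf₀ (hT.restrict hfix f) :=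
  ⟨(divMap hf₀ ∘ₗ hT.restrict hfix).extendOfNorm (divMap hf₀), fun f =>
    LinearMap.extendOfNorm_eq (denseRange_divMap hf₀)
      ⟨1, fun g => by simpa using hT.norm_divMap_restrict_le hp hf₀ hcontr hfix g⟩ f⟩

variable {T : ℝ≥0 → (Lp ℝ p μ →L[ℝ] Lp ℝ p μ)}
  {P : ℝ≥0 → Lp ℝ 2 (weightedMeasure f₀) →L[ℝ] Lp ℝ 2 (weightedMeasure f₀)}

theorem isMarkovSemigroup_of_divMap (hp : p ≠ ∞) (hf₀ : ∀ᵐ x ∂μ, 0 < f₀ x)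
    (hpos : ∀ t, IsPositiveOp (T t)) (hcontr : ∀ t (f : Lp ℝ p μ), ‖T t f‖ ≤ ‖f‖)
    (hT0 : T 0 = ContinuousLinearMap.id ℝ (Lp ℝ p μ))
    (hsem : ∀ s t, T (s + t) = (T s).comp (T t))
    (hcont : ∀ f : Lp ℝ p μ, Continuous fun t => T t f) (hfix : ∀ t, T t f₀ = f₀)
    (hdiv : ∀ t (f : boundedBy f₀),
      P t (divMap hf₀ f) = divMap hf₀ ((hpos t).restrict (hfix t) f)) :
    IsMarkovSemigroup P := by
  have hnorm : ∀ t f, ‖P t f‖ ≤ ‖f‖ := fun t f => by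
    refine (denseRange_divMap hf₀).induction_on f (isClosed_le (by fun_prop) (by fun_prop))
      fun a => ?_
    rw [hdiv]
    exact (hpos t).norm_divMap_restrict_le hp hf₀ (hcontr t) (hfix t) a
  refine ⟨⟨hnorm, fun f => ?_, fun s t f => ?_, fun h => ?_⟩, fun t h hh => ?_, fun t => ?_⟩
  · refine (denseRange_divMap hf₀).induction_on f (isClosed_eq (by fun_prop) (by fun_prop))
      fun a => ?_
    rw [hdiv]
    congr 1
    refine Subtype.ext ?_
    rw [IsPositiveOp.coe_restrict, hT0]
    rfl
  · refine (denseRange_divMap hf₀).induction_on f (isClosed_eq (by fun_prop) (by fun_prop))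
      fun a => ?_
    rw [hdiv, hdiv, hdiv]
    congr 1
    refine Subtype.ext ?_
    rw [IsPositiveOp.coe_restrict, hsem]
    rfl
  · obtain ⟨F, -, hF⟩ := exists_tendsto_divMap hf₀ h
    refine continuous_of_uniform_approx_of_continuous fun u hu => ?_
    obtain ⟨ε, hε, hεu⟩ := Metric.mem_uniformity_dist.1 hu
    obtain ⟨n, hn⟩ := (hF.eventually (Metric.ball_mem_nhds h hε)).exists
    refine ⟨fun t => P t (divMap hf₀ (F n)), ?_, fun t => hεu ?_⟩
    · obtain ⟨c, hc⟩ := (F n).2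
      simp_rw [hdiv]
      rw [continuous_iff_continuousAt]
      intro t
      have hb : ∀ s, |((hpos s).restrict (hfix s) (F n) : Lp ℝ p μ)| ≤ c • f₀ := fun s =>
        (hpos s).abs_apply_le_smul (hfix s) hc
      have hc' : Tendsto (fun s => ((hpos s).restrict (hfix s) (F n) : Lp ℝ p μ)) (nhds t)
          (nhds ((hpos t).restrict (hfix t) (F n) : Lp ℝ p μ)) := (hcont (F n)).continuousAt
      exact (tendsto_divMap_iff hp hf₀ hb).2 hc'
    · rw [dist_eq_norm, ← map_sub]
      refine (hnorm t _).trans_lt ?_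
      rwa [← dist_eq_norm, dist_comm]
  · obtain ⟨F, hF0, hF⟩ := exists_tendsto_divMap hf₀ h
    refine ge_of_tendsto' (((P t).continuous.tendsto h).comp hF) fun n => ?_
    rw [Function.comp_apply, hdiv, divMap_nonneg]
    exact hpos t _ (hF0 hh n)
  · rw [← divMap_self hf₀, hdiv]
    exact congrArg _ (Subtype.ext (hfix t))

theorem kernelSeesFixed_of_divMap (hf₀ : ∀ᵐ x ∂μ, 0 < f₀ x)
    (hpos : ∀ t, IsPositiveOp (T t)) (hfix : ∀ t, T t f₀ = f₀)
    (hstar : ∀ f : Lp ℝ p μ, 0 ≤ f → f ≠ 0 → (∀ t, T t f = f) →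
      ∃ (t : ℝ≥0) (K : Lp ℝ p μ →L[ℝ] Lp ℝ p μ), IsPositiveOp K ∧ IsIntegralOp K ∧
        (∀ g : Lp ℝ p μ, 0 ≤ g → K g ≤ T t g) ∧ K f ≠ 0)
    (hdiv : ∀ t (f : boundedBy f₀),
      P t (divMap hf₀ f) = divMap hf₀ ((hpos t).restrict (hfix t) f)) :
    KernelSeesFixed P := by
  rintro h hh ⟨c, hc⟩ hne hPh
  obtain ⟨f, rfl⟩ := exists_divMap_eq hf₀ (h := h) (c := c) (by rwa [abs_of_nonneg hh])
  rw [divMap_nonneg] at hh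
  obtain ⟨t, K, hKpos, ⟨k, hkm, hk0, hk⟩, hKT, hKf⟩ := hstar f hh
    (fun h0 => hne (by rw [← map_zero (divMap hf₀)]; exact congrArg _ (Subtype.ext h0)))
    fun t => congrArg Subtype.val (divMap_injective hf₀ ((hdiv t f).symm.trans (hPh t)))
  have hf₀m : Measurable f₀ := (Lp.stronglyMeasurable f₀).measurable
  obtain ⟨κ, hκdef⟩ : ∃ κ : Ω → Ω → ℝ, ∀ x y,
      κ x y = max 0 (min 1 (k x y * f₀ x ^ (1 - p.toReal) * (f₀ y)⁻¹)) := ⟨_, fun _ _ => rfl⟩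
  have hκ : IsUnitKernel κ := by
    refine ⟨?_, fun x y => hκdef x y ▸ le_max_left _ _, fun x y => ?_⟩
    · have h1 : Function.uncurry κ = fun z : Ω × Ω => max 0 (min 1 (Function.uncurry k z *
          f₀ z.1 ^ (1 - p.toReal) * (f₀ z.2)⁻¹)) := funext fun z => hκdef z.1 z.2
      rw [h1]
      exact measurable_const.max (measurable_const.min ((hkm.mul
        ((hf₀m.comp measurable_fst).pow_const _)).mul (hf₀m.comp measurable_snd).inv))
    · rw [hκdef]
      exact max_le zero_le_one (min_le_left _ _)
  refine ⟨t, κ, hκ, ?_, ?_⟩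
  · rintro g hg ⟨d, hd⟩
    obtain ⟨a, rfl⟩ := exists_divMap_eq hf₀ (h := g) (c := d) (by rwa [abs_of_nonneg hg])
    rw [divMap_nonneg] at hg
    obtain ⟨hintg, hKa⟩ := hk a
    simp only [hdiv]
    filter_upwards [ae_weightedMeasure_of_ae f₀ hintg, ae_weightedMeasure_of_ae f₀ hKa,
      ae_weightedMeasure_of_ae f₀ ((Lp.coeFn_le _ _).2 (hKT a hg)), ae_weightedMeasure_of_ae f₀ hf₀,
      coeFn_divMap hf₀ ((hpos t).restrict (hfix t) a)] with y h1 h2 h3 h4 h5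
    rw [h5, IsPositiveOp.coe_restrict, le_div_iff₀ h4]
    refine le_trans ?_ h3
    rw [h2, kernelInt, integral_weightedMeasure hf₀, ← integral_mul_const]
    refine integral_mono_of_nonneg ?_ h1 ?_
    · filter_upwards [hf₀, coeFn_eq_mul_divMap hf₀ a, (Lp.coeFn_nonneg _).2 hg] with x h6 h7 h8
      have h9 : 0 ≤ divMap hf₀ a x := nonneg_of_mul_nonneg_right (h7 ▸ h8) h6
      have := hκ.nonneg x y
      change 0 ≤ _
      positivity
    · filter_upwards [hf₀, coeFn_eq_mul_divMap hf₀ a, (Lp.coeFn_nonneg _).2 hg] with x h6 h7 h8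
      have h9 : 0 ≤ divMap hf₀ a x := nonneg_of_mul_nonneg_right (h7 ▸ h8) h6
      have h10 : κ x y ≤ k x y * f₀ x ^ (1 - p.toReal) * (f₀ y)⁻¹ := by
        have := hk0 x y
        rw [hκdef]
        exact max_le (by positivity) (min_le_right _ _)
      calc f₀ x ^ p.toReal * (κ x y * divMap hf₀ a x) * f₀ y
          ≤ f₀ x ^ p.toReal * (k x y * f₀ x ^ (1 - p.toReal) * (f₀ y)⁻¹ * divMap hf₀ a x)
            * f₀ y := by gcongr
        _ = k x y * (f₀ x ^ p.toReal * f₀ x ^ (1 - p.toReal)) * divMap hf₀ a x *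
            ((f₀ y)⁻¹ * f₀ y) := by ring
        _ = k x y * a.1 x := by
          rw [← Real.rpow_add h6, inv_mul_cancel₀ h4.ne', h7]
          simp [mul_assoc]
  · have hnn : 0 ≤ divMap hf₀ f := (divMap_nonneg hf₀).2 hh
    refine (integral_nonneg fun y => hκ.kernelInt_nonneg hnn y).lt_of_ne fun h0 => hKf ?_
    have h1 := (integral_eq_zero_iff_of_nonneg (fun y => hκ.kernelInt_nonneg hnn y)
      (hκ.integrable_kernelInt _)).1 h0.symm
    refine Lp.ext ?_
    filter_upwards [ae_of_ae_weightedMeasure hf₀ h1, (hk f).2, hf₀, Lp.coeFn_zero ℝ p μ]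
      with y h2 h3 h4 h5
    rw [h3, h5, Pi.zero_apply]
    have h6 : 0 ≤ᵐ[weightedMeasure f₀] fun x => κ x y * divMap hf₀ f x := by
      filter_upwards [(Lp.coeFn_nonneg _).2 hnn] with x hx
      exact mul_nonneg (hκ.nonneg x y) hx
    have h7 : Integrable (fun x => κ x y * divMap hf₀ f x) (weightedMeasure f₀) :=
      (L2_integrable (divMap hf₀ f)).bdd_mul (c := 1)
        (hκ.memLp_section y).aestronglyMeasurable (ae_of_all _ fun x => by
          rw [Real.norm_eq_abs, abs_of_nonneg (hκ.nonneg x y)]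
          exact hκ.le_one x y)
    have h8 := (integral_eq_zero_iff_of_nonneg_ae h6 h7).1 h2
    refine integral_eq_zero_of_ae ?_
    filter_upwards [ae_of_ae_weightedMeasure hf₀ h8, coeFn_eq_mul_divMap hf₀ f, hf₀]
      with x h9 h10 h11
    rw [h10, Pi.zero_apply]
    rcases mul_eq_zero.1 h9 with h12 | h12
    · have h13 : k x y * f₀ x ^ (1 - p.toReal) * (f₀ y)⁻¹ ≤ 0 := by
        by_contra! hlt
        have := hκdef x y
        rw [h12] at this
        exact (lt_min zero_lt_one hlt).not_ge (this ▸ le_max_right _ _)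
      have h14 : k x y = 0 := by
        refine (hk0 x y).antisymm' ?_
        by_contra! hlt
        exact (mul_pos (mul_pos hlt (Real.rpow_pos_of_pos h11 _)) (inv_pos.2 h4)).not_ge h13
      rw [h14, zero_mul]
    · rw [h12, mul_zero, mul_zero]

end Transfer

/-- A family of contractions that converges strongly on a dense set converges strongly. -/
theorem exists_tendsto_of_dense {E : Type*} [NormedAddCommGroup E] [NormedSpace ℝ E]
    [CompleteSpace E] {T : ℝ≥0 → E →L[ℝ] E} (hcontr : ∀ t f, ‖T t f‖ ≤ ‖f‖) {V : Set E}
    (hV : Dense V) (h : ∀ f ∈ V, ∃ g, Tendsto (fun t => T t f) atTop (nhds g)) (f : E) :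
    ∃ g, Tendsto (fun t => T t f) atTop (nhds g) := by
  refine cauchySeq_tendsto_of_complete (Metric.cauchySeq_iff'.2 fun ε hε => ?_)
  obtain ⟨f', hf', hff'⟩ := hV.exists_dist_lt f (ε := ε / 3) (by positivity)
  obtain ⟨g, hg⟩ := h f' hf'
  obtain ⟨N, hN⟩ := Metric.cauchySeq_iff'.1 hg.cauchySeq (ε / 3) (by positivity)
  have hd : ∀ t, dist (T t f) (T t f') < ε / 3 := fun t => by
    rw [dist_eq_norm, ← map_sub]
    exact (hcontr t _).trans_lt (by rwa [← dist_eq_norm])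
  refine ⟨N, fun n hn => ?_⟩
  have h1 := dist_triangle4 (T n f) (T n f') (T N f') (T N f)
  have h2 := hd N
  rw [dist_comm] at h2
  linarith [hd n, hN n hn]

/-- A positive contractive `C₀`-semigroup on `L^p` over a σ-finite measure space with an
a.e. strictly positive fixed point converges strongly as `t → ∞` provided that every
nonzero positive fixed point is "seen" by an integral operator dominated by some `T t`. -/
theorem pichor_rudnicki_convergence
    {Ω : Type*} [MeasurableSpace Ω] (μ : Measure Ω) [SigmaFinite μ]
    (p : ℝ≥0∞) [Fact (1 ≤ p)] (hp : p ≠ ∞)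
    (T : ℝ≥0 → (Lp ℝ p μ →L[ℝ] Lp ℝ p μ))
    (hpos : ∀ t, IsPositiveOp (T t))
    (hcontr : ∀ t (f : Lp ℝ p μ), ‖T t f‖ ≤ ‖f‖)
    (hT0 : T 0 = ContinuousLinearMap.id ℝ (Lp ℝ p μ))
    (hsem : ∀ s t, T (s + t) = (T s).comp (T t))
    (hcont : ∀ f : Lp ℝ p μ, Continuous fun t => T t f)
    (f₀ : Lp ℝ p μ) (hfix : ∀ t, T t f₀ = f₀)
    (hf₀pos : ∀ᵐ x ∂μ, 0 < f₀ x)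
    (hstar : ∀ f : Lp ℝ p μ, 0 ≤ f → f ≠ 0 → (∀ t, T t f = f) →
      ∃ (t : ℝ≥0) (K : Lp ℝ p μ →L[ℝ] Lp ℝ p μ), IsPositiveOp K ∧ IsIntegralOp K ∧
        (∀ g : Lp ℝ p μ, 0 ≤ g → K g ≤ T t g) ∧ K f ≠ 0) :
    ∀ f : Lp ℝ p μ, ∃ g : Lp ℝ p μ, Tendsto (fun t => T t f) atTop (nhds g) := by
  have := isFiniteMeasure_weightedMeasure hp hf₀pos
  refine exists_tendsto_of_dense hcontr (dense_boundedBy hp hf₀pos) ?_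
  rintro f ⟨c, hc⟩
  choose P hdiv using fun t =>
    (hpos t).exists_apply_divMap_eq hp hf₀pos (hcontr t) (hfix t)
  have hP := isMarkovSemigroup_of_divMap hp hf₀pos hpos hcontr hT0 hsem hcont hfix hdiv
  have hK := kernelSeesFixed_of_divMap hf₀pos hpos hfix hstar hdiv
  have hc' := (abs_divMap_le hf₀pos (f := ⟨f, c, hc⟩)).2 hc
  have hlim := hP.tendsto_apply hK hc'
  obtain ⟨g, hg⟩ := exists_divMap_eq hf₀pos (hP.abs_starProjection_le_smul_one hc')
  rw [← hg] at hlim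
  simp_rw [hdiv] at hlim
  have hb : ∀ t, |((hpos t).restrict (hfix t) ⟨f, c, hc⟩ : Lp ℝ p μ)| ≤ c • f₀ := fun t =>
    (hpos t).abs_apply_le_smul (hfix t) hc
  exact ⟨g, (tendsto_divMap_iff hp hf₀pos hb).1 hlim⟩
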